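/- arXiv:cs/0512051 — 2 statements merged into one kernel-verified Lean document; each statement's English description precedes it below -/
import Mathlib

section
/- Let k ≥ 3, A an alphabet with at least two letters, and define T_{A,k} = U_{k,A} ∪ (kPF(A) ∩ V_{k,A}), where U_{k,A} is the set of k-power-free words over A of length at most k+1, kPF(A) is the set of k-power-free words over A, and V_{k,A} is the set of words of the form a_0 w_1 a_1 w_2 ... a_{k-1} w_k a_k with each a_i a letter, ||w_i| - |w_j|| ≤ 1 for all i, j, and each letter occurring at most once in each w_i. Then a uniform morphism f on A is k-power-free if and only if f(T_{A,k}) is k-power-free. -/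
/-- n-fold power of a word (list) under concatenation. -/
def wpow {α : Type*} (u : List α) (n : ℕ) : List α := (List.replicate n u).flatten

/-- A word is k-power-free if it contains no factor `u^k` with `u` non-empty. -/
def kPowerFree {α : Type*} (k : ℕ) (w : List α) : Prop :=
  ∀ u : List α, u ≠ [] → ¬ (wpow u k <:+: w)

/-- Extension of a letter map to a morphism of free monoids. -/
def applyMorph {α β : Type*} (g : α → List β) (w : List α) : List β := w.flatMap g

/-- Membership in the set V_{k,A}. -/
def memV {α : Type*} [DecidableEq α] (k : ℕ) (w : List α) : Prop :=
  ∃ (a : ℕ → α) (ws : ℕ → List α),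
    w = [a 0] ++ (List.range k).flatMap (fun i => ws (i+1) ++ [a (i+1)]) ∧
    (∀ i j, 1 ≤ i → i ≤ k → 1 ≤ j → j ≤ k → (ws i).length ≤ (ws j).length + 1) ∧
    (∀ i, 1 ≤ i → i ≤ k → ∀ c : α, (ws i).count c ≤ 1)

/-- Membership in the test-set T_{A,k}. -/
def memT {α : Type*} [DecidableEq α] (k : ℕ) (w : List α) : Prop :=
  (kPowerFree k w ∧ w.length ≤ k + 1) ∨ (kPowerFree k w ∧ memV k w)


def PerOn {γ : Type*} (s : ℕ → γ) (p d l : ℕ) : Prop :=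
  ∀ z, p ≤ z → z + d < p + l → s z = s (z + d)

def PowFr {γ : Type*} (k n : ℕ) (s : ℕ → γ) : Prop :=
  ∀ p d, 1 ≤ d → p + k * d ≤ n → ¬ PerOn s p d (k * d)

def FF {α γ : Type*} (G : α → ℕ → γ) (L : ℕ) (W : ℕ → α) (z : ℕ) : γ := G (W (z / L)) (z % L)

def HypU {α γ : Type*} (G : α → ℕ → γ) (L k : ℕ) : Prop :=
  ∀ (W : ℕ → α) (n : ℕ), n ≤ k + 1 → PowFr k n W → PowFr k (n * L) (FF G L W)

def HypV {α γ : Type*} (G : α → ℕ → γ) (L k : ℕ) : Prop :=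
  ∀ (W : ℕ → α) (n : ℕ) (I : ℕ → ℕ), I 0 = 0 → I k + 1 = n → (∀ i < k, I i < I (i+1)) →
    (∀ i < k, ∀ j < k, I (i+1) + I j ≤ I (j+1) + I i + 1) →
    (∀ i < k, ∀ x y, I i < x → x < y → y < I (i+1) → W x ≠ W y) →
    PowFr k n W → PowFr k (n * L) (FF G L W)

section basics
variable {α γ : Type*} {G : α → ℕ → γ} {L k : ℕ}

theorem FF_eq (W : ℕ → α) {n t : ℕ} (ht : t < L) : FF G L W (n * L + t) = G (W n) t := by
  unfold FF
  rw [Nat.mul_comm n L, Nat.mul_add_div (by omega), Nat.div_eq_of_lt ht, Nat.mul_add_mod,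
    Nat.mod_eq_of_lt ht, Nat.add_zero]

theorem FF_eq' (W : ℕ → α) {z n t : ℕ} (ht : t < L) (hz : z = n * L + t) :
    FF G L W z = G (W n) t := by
  rw [hz, FF_eq W ht]

theorem split_div (hL : 0 < L) (z : ℕ) : ∃ n t, t < L ∧ z = n * L + t :=
  ⟨z / L, z % L, Nat.mod_lt _ hL, by rw [Nat.mul_comm]; exact (Nat.div_add_mod z L).symm⟩

theorem FF_shift (hL : 0 < L) (W : ℕ → α) (n z : ℕ) :
    FF G L W (n * L + z) = FF G L (fun i => W (n + i)) z := by
  obtain ⟨q, t, ht, rfl⟩ := split_div hL z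
  rw [FF_eq _ ht, ← Nat.add_assoc, ← Nat.add_mul, FF_eq _ ht]

theorem PowFr_mono {n n' : ℕ} {s : ℕ → γ} (h : PowFr k n s) (hn : n' ≤ n) : PowFr k n' s :=
  fun p d hd hp => h p d hd (by omega)

theorem PowFr_shift {n j : ℕ} {s : ℕ → γ} (h : PowFr k n s) (hj : j ≤ n) :
    PowFr k (n - j) (fun i => s (j + i)) := by
  intro p d hd hp hper
  refine h (j + p) d hd (by omega) ?_
  intro z hz hz'
  have := hper (z - j) (by omega) (by omega)
  simp only at this
  rw [show j + (z - j) = z by omega, show j + (z - j + d) = z + d by omega] at this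
  exact this

theorem PowFr_rev {n : ℕ} {s : ℕ → γ} (h : PowFr k n s) : PowFr k n (fun i => s (n - 1 - i)) := by
  intro p d hd hp hper
  refine h (n - p - k * d) d hd (by omega) ?_
  intro z hz hz'
  have := hper (n - 1 - z - d) (by omega) (by omega)
  simp only at this
  rw [show n - 1 - (n - 1 - z - d) = z + d by omega,
    show n - 1 - (n - 1 - z - d + d) = z by omega] at this
  exact this.symm

theorem PowFr_congr {δ : Type*} {n : ℕ} {s : ℕ → γ} {s' : ℕ → δ}
    (h : ∀ i j, i < n → j < n → (s' i = s' j → s i = s j)) (hs : PowFr k n s) : PowFr k n s' := by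
  intro p d hd hp hper
  exact hs p d hd hp fun z hz hz' => h _ _ (by omega) (by omega) (hper z hz hz')

/-- the ps property -/
theorem ps_prop (hk : 3 ≤ k) (hL : 0 < L) (H : HypU G L k) (a b c : α) (r : ℕ) (hr : r ≤ L)
    (h1 : ∀ t < r, G a t = G b t) (h2 : ∀ t, r ≤ t → t < L → G a t = G c t) : b = a ∨ c = a := by
  by_contra hcon
  push Not at hcon
  obtain ⟨hb, hc⟩ := hcon
  let W : ℕ → α := fun i => if i = 0 then c else if i = k then b else a
  have W0 : W 0 = c := by simp [W]
  have Wk : W k = b := by simp [W]; omega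
  have Wm : ∀ i, 0 < i → i < k → W i = a := by
    intro i h h'; simp [W]; grind
  have hPF : PowFr k (k+1) W := by
    intro p d hd hp hper
    have hd1 : d = 1 := by
      by_contra h
      have : k * 2 ≤ k * d := Nat.mul_le_mul_left k (by omega)
      omega
    subst hd1
    have hp' : p = 0 ∨ p = 1 := by omega
    rcases hp' with rfl | rfl
    · have := hper 0 (by omega) (by omega)
      rw [W0, Wm _ (by omega) (by omega)] at this
      exact hc this
    · have := hper (k-1) (by omega) (by omega)
      rw [Wm _ (by omega) (by omega), show k - 1 + 1 = k by omega, Wk] at this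
      exact hb this.symm
  refine H W (k+1) le_rfl hPF r L hL (by rw [Nat.add_mul]; omega) ?_
  intro z hz hz'
  obtain ⟨n, t, ht, rfl⟩ := split_div hL z
  rw [FF_eq _ ht, FF_eq' (n := n+1) _ ht (by ring)]
  have hn : n < k := by
    by_contra h
    have : k * L ≤ n * L := Nat.mul_le_mul_right L (by omega)
    omega
  have e1 : G (W n) t = G a t := by
    rcases Nat.eq_zero_or_pos n with rfl | h
    · rw [W0, h2 t (by omega) ht]
    · rw [Wm n h hn]
  have e2 : G (W (n+1)) t = G a t := by
    rcases Nat.lt_or_ge (n+1) k with h | h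
    · rw [Wm _ (by omega) h]
    · have : n + 1 = k := by omega
      subst this
      rw [Wk, h1 t]
      have : (n+1) * L = n * L + L := by ring
      omega
  rw [e1, e2]

theorem inj_prop [Nontrivial α] (hk : 3 ≤ k) (hL : 0 < L) (H : HypU G L k) (a b : α)
    (h1 : ∀ t < L, G a t = G b t) : b = a := by
  obtain ⟨c, hc⟩ := exists_ne a
  rcases ps_prop hk hL H a b c L le_rfl h1 (fun t h h' => by omega) with h | h
  · exact h
  · exact absurd h hc

/-- the period is a multiple of `L` -/
theorem mult_case [Nontrivial α] (hk : 3 ≤ k) (hL : 0 < L) (H : HypU G L k) (W : ℕ → α) (n p q : ℕ)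
    (hq : 1 ≤ q) (hW : PowFr k n W) (hp : p + k * (q * L) ≤ n * L)
    (hper : PerOn (FF G L W) p (q * L) (k * (q * L))) : False := by
  obtain ⟨j, r, hr, rfl⟩ := split_div hL p
  have hkq : k * (q * L) = (k * q) * L := by ring
  have key : ∀ i t, t < L → j * L + r ≤ i * L + t → i * L + t + q * L < j * L + r + k * (q * L) →
      G (W i) t = G (W (i + q)) t := by
    intro i t ht h1 h2
    have := hper (i * L + t) h1 h2
    rwa [FF_eq _ ht, FF_eq' (n := i + q) _ ht (by ring)] at this
  obtain ⟨K, rfl⟩ : ∃ K, k = K + 1 := ⟨k - 1, by omega⟩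
  have e1 : (K + 1) * (q * L) = (K * q) * L + q * L := by ring
  have full : ∀ i, j < i → i < j + K * q → W i = W (i + q) := by
    intro i h1 h2
    symm
    apply inj_prop hk hL H
    intro t ht
    have a1 : (j + 1) * L ≤ i * L := Nat.mul_le_mul_right L h1
    have a2 : (i + 1) * L ≤ (j + K * q) * L := Nat.mul_le_mul_right L h2
    rw [Nat.add_mul] at a1 a2
    rw [Nat.add_mul] at a2
    exact key i t ht (by omega) (by omega)
  have chain : ∀ i, i + 1 ≤ K → W (j + q) = W (j + (i + 1) * q) := by
    intro i
    induction i with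
    | zero => intro _; simp
    | succ i ih =>
      intro hi
      rw [ih (by omega), full]
      · congr 1; ring
      · have : 0 < (i + 1) * q := by positivity
        omega
      · have : (i + 1 + 1) * q ≤ K * q := Nat.mul_le_mul_right q hi
        have e : (i + 1 + 1) * q = (i + 1) * q + q := by ring
        omega
  have hlast : W (j + q) = W (j + K * q) := by
    have := chain (K - 1) (by omega)
    rwa [show K - 1 + 1 = K by omega] at this
  have hqK : q ≤ K * q := Nat.le_mul_of_pos_left q (by omega)
  have hqKL : q * L ≤ K * q * L := Nat.mul_le_mul_right L hqK
  have hqL : L ≤ q * L := Nat.le_mul_of_pos_left L hq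
  have h0 : ∀ t, r ≤ t → t < L → G (W (j + q)) t = G (W j) t := by
    intro t h1 h2
    refine (key j t h2 (by omega) ?_).symm
    have : 2 * q ≤ K * q := Nat.mul_le_mul_right q (by omega)
    have : 2 * q * L ≤ K * q * L := Nat.mul_le_mul_right L this
    have e : 2 * q * L = q * L + q * L := by ring
    omega
  have hend : ∀ t < r, G (W (j + q)) t = G (W (j + K * q + q)) t := by
    intro t ht
    rw [hlast]
    refine key (j + K * q) t (by omega) ?_ ?_
    · rw [Nat.add_mul]; omega
    · rw [Nat.add_mul]; omega
  have e2 : (K + 1) * q = K * q + q := by ring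
  have hA : W j = W (j + q) → False := by
    intro h
    refine hW j q hq ?_ ?_
    · have : (j + (K + 1) * q) * L ≤ n * L := by rw [Nat.add_mul, ← hkq]; omega
      exact Nat.le_of_mul_le_mul_right this hL
    · intro z hz hz'
      rcases Nat.eq_or_lt_of_le hz with rfl | hz
      · exact h
      · exact full z hz (by omega)
  have hB : 0 < r → W (j + K * q + q) = W (j + q) → False := by
    intro hr0 h
    refine hW (j + 1) q hq ?_ ?_
    · have : (j + (K + 1) * q) * L < n * L := by rw [Nat.add_mul, ← hkq]; omega
      have := Nat.lt_of_mul_lt_mul_right this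
      omega
    · intro z hz hz'
      rcases Nat.lt_or_ge z (j + K * q) with h1 | h1
      · exact full z (by omega) h1
      · have : z = j + K * q := by omega
        subst this
        rw [h, hlast]
  rcases Nat.eq_zero_or_pos r with h | h
  · exact hA (inj_prop hk hL H _ _ fun t ht => h0 t (by omega) ht)
  · rcases ps_prop hk hL H _ _ _ r hr.le hend h0 with h' | h'
    · exact hB h h'
    · exact hA h'

/-- short period -/
theorem short_case (hL : 0 < L) (H : HypU G L k) (W : ℕ → α) (n p d : ℕ)
    (hd : 1 ≤ d) (hdL : d < L) (hW : PowFr k n W) (hp : p + k * d ≤ n * L)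
    (hper : PerOn (FF G L W) p d (k * d)) : False := by
  obtain ⟨j, r, hr, rfl⟩ := split_div hL p
  have hj : j ≤ n := by
    have : j * L ≤ n * L := by omega
    exact Nat.le_of_mul_le_mul_right this hL
  have h1 : k * d + k ≤ k * L := by
    have : k * (d + 1) ≤ k * L := Nat.mul_le_mul_left k hdL
    rwa [Nat.mul_add, Nat.mul_one] at this
  have hPF := PowFr_mono (PowFr_shift hW hj) (Nat.min_le_right (k + 1) (n - j))
  refine H _ (min (k + 1) (n - j)) (Nat.min_le_left _ _) hPF r d hd ?_ ?_
  · rcases Nat.le_total (k + 1) (n - j) with h | h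
    · rw [Nat.min_eq_left h, Nat.add_mul]; omega
    · rw [Nat.min_eq_right h, Nat.sub_mul]; omega
  · intro z hz hz'
    have := hper (j * L + z) (by omega) (by omega)
    rwa [Nat.add_assoc, FF_shift hL, FF_shift hL] at this

/-- a periodic word whose image has small period everywhere -/
theorem small_period (hk : 3 ≤ k) (hL : 0 < L) (H : HypU G L k) (V : ℕ → α) (h : ℕ)
    (h1 : 1 ≤ h) (hhL : h < L) (hper : ∀ z, FF G L V z = FF G L V (z + h)) : False := by
  by_cases hc : ∃ i, V i ≠ V (i + 1)
  · obtain ⟨i, hi⟩ := hc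
    refine H (fun j => V (i + j)) k (by omega) ?_ 0 h h1 ?_ ?_
    · intro p d hd hp hper
      have hd1 : d = 1 := by
        by_contra h
        have : k * 2 ≤ k * d := Nat.mul_le_mul_left k (by omega)
        omega
      subst hd1
      have := hper 0 (by omega) (by omega)
      exact hi this
    · have := Nat.mul_le_mul_left k hhL.le
      omega
    · intro z _ _
      rw [← FF_shift hL, ← FF_shift hL, ← Nat.add_assoc]
      exact hper _
  · push Not at hc
    have hL1 : ∀ z, FF G L V z = FF G L V (z + L) := by
      intro z
      obtain ⟨q, t, ht, rfl⟩ := split_div hL z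
      rw [FF_eq _ ht, FF_eq' (n := q + 1) _ ht (by ring), ← hc q]
    have main : ∀ h', 1 ≤ h' → 2 * h' ≤ L → (∀ z, FF G L V z = FF G L V (z + h')) → False := by
      intro h' h1 h2 h3
      refine H V (k - 1) (by omega) ?_ 0 h' h1 ?_ ?_
      · intro p d hd hp _
        have : k * 1 ≤ k * d := Nat.mul_le_mul_left k hd
        omega
      · obtain ⟨K, rfl⟩ : ∃ K, k = K + 2 := ⟨k - 2, by omega⟩
        simp only [show K + 2 - 1 = K + 1 by omega]
        nlinarith
      · intro z _ _
        exact h3 z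
    rcases Nat.le_total (2 * h) L with h2 | h2
    · exact main h h1 h2 hper
    · refine main (L - h) (by omega) (by omega) fun z => ?_
      rw [hper (z + (L - h)), hL1 z]
      congr 1
      omega

end basics

section fw
theorem fine_wilf_aux {γ : Type*} (s : ℕ → γ) (p l : ℕ) : ∀ N a b, a + b ≤ N → a + b ≤ l →
    PerOn s p a l → PerOn s p b l → PerOn s p (Nat.gcd a b) l := by
  have step : ∀ a b, a ≤ b → a + b ≤ l → PerOn s p a l → PerOn s p b l → PerOn s p (b - a) l := by
    intro a b hab hl ha hb z hz hz'
    rcases Nat.lt_or_ge (z + b) (p + l) with h | h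
    · have h1 := hb z hz h
      have h2 := ha (z + (b - a)) (by omega) (by omega)
      rw [show z + (b - a) + a = z + b by omega] at h2
      rw [h1, h2]
    · have h1 := ha (z - a) (by omega) (by omega)
      have h2 := hb (z - a) (by omega) (by omega)
      rw [show z - a + a = z by omega] at h1
      rw [show z - a + b = z + (b - a) by omega] at h2
      rw [← h1, h2]
  intro N
  induction N with
  | zero =>
    intro a b h hl ha hb
    have h1 : a = 0 := by omega
    have h2 : b = 0 := by omega
    subst h1 h2
    simpa using ha
  | succ N ih =>
    intro a b h hl ha hb
    rcases Nat.eq_zero_or_pos a with rfl | ha0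
    · simpa using hb
    rcases Nat.eq_zero_or_pos b with rfl | hb0
    · simpa using ha
    rcases Nat.le_total a b with hab | hab
    · have := ih a (b - a) (by omega) (by omega) ha (step a b hab hl ha hb)
      rwa [Nat.gcd_sub_self_right hab] at this
    · have := ih (a - b) b (by omega) (by omega) (step b a hab (by omega) hb ha) hb
      rwa [Nat.gcd_sub_self_left hab] at this

theorem fine_wilf {γ : Type*} {s : ℕ → γ} {p l a b : ℕ} (hl : a + b ≤ l)
    (ha : PerOn s p a l) (hb : PerOn s p b l) : PerOn s p (Nat.gcd a b) l :=
  fine_wilf_aux s p l _ a b le_rfl hl ha hb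
end fw

section special
variable {α γ : Type*} {G : α → ℕ → γ} {L : ℕ}

theorem two_letters (H : HypU G L 3) (W : ℕ → α) (p d : ℕ) (hd : 1 ≤ d) (hp : p + 3 * d ≤ 2 * L)
    (hper : PerOn (FF G L W) p d (3 * d)) : False := by
  refine H W 2 (by omega) ?_ p d hd hp hper
  intro p d hd hp _
  omega

/-- the exceptional case `k = 3`, `W = aaa...` -/
theorem special_start (hL : 0 < L) (H : HypU G L 3) (W : ℕ → α) (p e : ℕ)
    (h01 : W 1 = W 0) (h02 : W 2 = W 0) (hp : p < L) (he : 0 < e) (heL : e < L) (hpe : L < p + e)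
    (hper : PerOn (FF G L W) p (L + e) (3 * (L + e))) : False := by
  set a := W 0 with ha
  have P : ∀ i t i' t', t < L → t' < L → p ≤ i * L + t → i' * L + t' < p + 3 * (L + e) →
      i * L + t + (L + e) = i' * L + t' → G (W i) t = G (W i') t' := by
    intro i t i' t' ht ht' h1 h2 h3
    have := hper (i * L + t) h1 (by omega)
    rwa [FF_eq _ ht, FF_eq' _ ht' h3] at this
  have b1 : ∀ t < e, G (W 3) t = G a (L - e + t) := by
    intro t ht
    rw [← h01]
    exact (P 1 (L - e + t) 3 t (by omega) (by omega) (by omega) (by omega) (by omega)).symm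
  have b2 : ∀ t < L - e, G (W 3) (e + t) = G a t := by
    intro t ht
    rw [← h02]
    exact (P 2 t 3 (e + t) (by omega) (by omega) (by omega) (by omega) (by omega)).symm
  have hps := ps_prop (le_refl 3) hL H (W 3) (W 4) a (p + e - L) (by omega) (by
      intro t ht
      rw [b1 t (by omega), ← h02]
      exact P 2 (L - e + t) 4 t (by omega) (by omega) (by omega) (by omega) (by omega)) (by
      intro t ht1 ht2
      rcases Nat.lt_or_ge t e with h | h
      · rw [b1 t h]
        have := P 0 (L - e + t) 2 t (by omega) (by omega) (by omega) (by omega) (by omega)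
        rwa [h02] at this
      · have e1 := b2 (t - e) (by omega)
        rw [show e + (t - e) = t by omega] at e1
        rw [e1]
        have := P 1 (t - e) 2 t (by omega) (by omega) (by omega) (by omega) (by omega)
        rwa [h01, h02] at this)
  rcases hps with hc | hab
  · have xy : ∀ t, t < e → t < L - e → G a t = G a (L - e + t) := by
      intro t h1 h2
      rw [← b2 t h2, ← b1 t h1]
      have := P 3 t 4 (e + t) (by omega) (by omega) (by omega) (by omega) (by omega)
      rw [hc] at this
      exact this.symm
    rcases Nat.le_total (2 * e) L with h | h
    · let V : ℕ → α := fun i => if i = 0 then a else W 3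
      refine two_letters H V (L - e) e he (by omega) ?_
      intro z hz hz'
      rcases Nat.lt_or_ge z L with h1 | h1
      · rw [FF_eq' (n := 0) (t := z) _ h1 (by omega),
          FF_eq' (n := 1) (t := z + e - L) _ (by omega) (by omega)]
        show G a z = G (W 3) _
        rw [b1 _ (by omega)]
        congr 1; omega
      · rw [FF_eq' (n := 1) (t := z - L) _ (by omega) (by omega),
          FF_eq' (n := 1) (t := e + (z - L)) _ (by omega) (by omega)]
        show G (W 3) _ = G (W 3) _
        rw [b1 _ (by omega), b2 _ (by omega)]
        exact (xy _ (by omega) (by omega)).symm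
    · let V : ℕ → α := fun i => if i = 0 then W 3 else a
      refine two_letters H V e (L - e) (by omega) (by omega) ?_
      intro z hz hz'
      rcases Nat.lt_or_ge z L with h1 | h1
      · rw [FF_eq' (n := 0) (t := e + (z - e)) _ (by omega) (by omega),
          FF_eq' (n := 1) (t := z - e) _ (by omega) (by omega)]
        show G (W 3) _ = G a _
        rw [b2 _ (by omega)]
      · rw [FF_eq' (n := 1) (t := z - L) _ (by omega) (by omega),
          FF_eq' (n := 1) (t := L - e + (z - L)) _ (by omega) (by omega)]
        exact xy _ (by omega) (by omega)
  · refine small_period (le_refl 3) hL H (fun _ => a) (L - e) (by omega) (by omega) ?_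
    rw [← hab] at b1 b2
    intro z
    obtain ⟨q, t, ht, rfl⟩ := split_div hL z
    rw [FF_eq _ ht]
    rcases Nat.lt_or_ge t e with h | h
    · rw [FF_eq' (n := q) (t := L - e + t) _ (by omega) (by omega)]
      exact b1 t h
    · have e1 := b2 (t - e) (by omega)
      rw [show e + (t - e) = t by omega] at e1
      rw [FF_eq' (n := q + 1) (t := t - e) _ (by omega) (by rw [Nat.add_mul]; omega)]
      exact e1

theorem FF_rev (W : ℕ → α) (N z : ℕ) (hz : z < N * L) :
    FF (fun a t => G a (L - 1 - t)) L (fun i => W (N - 1 - i)) z = FF G L W (N * L - 1 - z) := by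
  have hL : 0 < L := by
    rcases Nat.eq_zero_or_pos L with h | h
    · subst h; omega
    · exact h
  obtain ⟨q, t, ht, rfl⟩ := split_div hL z
  have hq : q < N := by
    by_contra h
    have : N * L ≤ q * L := Nat.mul_le_mul_right L (by omega)
    omega
  obtain ⟨M, rfl⟩ : ∃ M, N = q + M + 1 := ⟨N - q - 1, by omega⟩
  rw [FF_eq _ ht, FF_eq' (n := M) (t := L - 1 - t) _ (by omega)]
  · congr 2; omega
  · have : (q + M + 1) * L = q * L + M * L + L := by ring
    omega

theorem HypU_rev {k : ℕ} (H : HypU G L k) : HypU (fun a t => G a (L - 1 - t)) L k := by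
  intro W n hn hW
  have h1 := PowFr_rev (H _ n hn (PowFr_rev hW))
  refine PowFr_congr ?_ h1
  have key : ∀ i < n * L, FF (fun a t => G a (L - 1 - t)) L W i =
      FF G L (fun i => W (n - 1 - i)) (n * L - 1 - i) := by
    intro i hi
    rw [← FF_rev _ _ _ hi]
    unfold FF
    have : i / L < n := Nat.div_lt_of_lt_mul (by rwa [Nat.mul_comm])
    have e : n - 1 - (n - 1 - i / L) = i / L := by
      generalize i / L = q at this ⊢
      omega
    simp only [e]
  intro i j hi hj h
  rw [key i hi, key j hj] at h
  exact h

/-- mirrored version: `W` has `N` letters, the last three being equal -/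
theorem special_end (hL : 0 < L) (H : HypU G L 3) (W : ℕ → α) (p e s : ℕ)
    (h01 : W (s + 1) = W s) (h02 : W (s + 2) = W s) (hp : p + 3 * (L + e) ≤ (s + 3) * L)
    (hp2 : (s + 2) * L < p + 3 * (L + e))
    (he : 0 < e) (heL : e < L) (hpe : p + 2 * (L + e) < (s + 1) * L)
    (hper : PerOn (FF G L W) p (L + e) (3 * (L + e))) : False := by
  have e3 : (s + 3) * L = s * L + 3 * L := by ring
  have e2 : (s + 2) * L = s * L + 2 * L := by ring
  have e1 : (s + 1) * L = s * L + L := by ring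
  refine special_start hL (HypU_rev H) (fun i => W (s + 3 - 1 - i))
    ((s + 3) * L - p - 3 * (L + e)) e ?_ ?_ (by omega) he heL (by omega) ?_
  · simp [h01, h02]
  · simp [h02]
  · intro z hz hz'
    rw [FF_rev _ _ _ (by omega), FF_rev _ _ _ (by omega)]
    have := hper ((s + 3) * L - 1 - (z + (L + e))) (by omega) (by omega)
    rw [this]
    congr 1
    omega
end special

section reduction
variable {α γ : Type*} {G : α → ℕ → γ} {L k : ℕ}

theorem per_mod {s : ℕ → γ} {p d l : ℕ} (h : PerOn s p d l) (r : ℕ) :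
    ∀ i, r + i * d < l → s (p + (r + i * d)) = s (p + r) := by
  intro i
  induction i with
  | zero => intro _; simp
  | succ i ih =>
    intro hi
    rw [Nat.add_mul, Nat.one_mul] at hi
    rw [← ih (by omega), h (p + (r + i * d)) (by omega) (by omega)]
    congr 1
    ring

theorem per_mod' {s : ℕ → γ} {p d l : ℕ} (h : PerOn s p d l) {y y' : ℕ} (hy : y < l) (hy' : y' < l)
    (hyy : y % d = y' % d) : s (p + y) = s (p + y') := by
  have e : ∀ y, y % d + y / d * d = y := fun y => by rw [Nat.mul_comm]; exact Nat.mod_add_div y d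
  have h1 := per_mod h (y % d) (y / d) (by rw [e]; exact hy)
  have h2 := per_mod h (y' % d) (y' / d) (by rw [e]; exact hy')
  rw [e] at h1 h2
  rw [h1, h2, hyy]

theorem reduction (hk : 3 ≤ k) (hL : 0 < L) (W : ℕ → α) (p d j m : ℕ)
    (hper : PerOn (FF G L W) p d (k * d)) (heq : W j = W (j + m))
    (h1 : p ≤ j * L) (h2 : (j + m + 1) * L ≤ p + k * d) (h3 : (m + 1) * L ≤ d) :
    ∃ W' p', PerOn (FF G L W') p' (d - m * L) (k * (d - m * L)) := by
  rw [Nat.add_mul, Nat.one_mul] at h3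
  rw [Nat.add_mul, Nat.add_mul, Nat.one_mul] at h2
  obtain ⟨D, hD⟩ : ∃ D, d = D + m * L := ⟨d - m * L, by omega⟩
  have hDd : d - m * L = D := by omega
  rw [hDd]
  have hDL : L ≤ D := by omega
  have hd0 : 0 < d := by omega
  generalize hM : m * L = M at *
  obtain ⟨x, i0, hx, hX⟩ : ∃ x i0, x < d ∧ j * L - p = i0 * d + x := by
    obtain ⟨q, t, ht, h⟩ := split_div hd0 (j * L - p)
    exact ⟨t, q, ht, h⟩
  have E : ∀ i t, t < L → x + i * d + t + M < k * d →
      FF G L W (p + (x + i * d + t)) = FF G L W (p + (x + i * d + t + M)) := by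
    intro i t ht hr
    have a1 : FF G L W (p + (x + i * d + t)) = FF G L W (p + (x + i0 * d + t)) := by
      refine per_mod' hper (by omega) (by omega) ?_
      rw [show x + i * d + t = x + t + i * d by ring, show x + i0 * d + t = x + t + i0 * d by ring,
        Nat.add_mul_mod_self_right, Nat.add_mul_mod_self_right]
    have a2 : FF G L W (p + (x + i * d + t + M)) = FF G L W (p + (x + i0 * d + t + M)) := by
      refine per_mod' hper (by omega) (by omega) ?_
      rw [show x + i * d + t + M = x + t + M + i * d by ring,
        show x + i0 * d + t + M = x + t + M + i0 * d by ring,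
        Nat.add_mul_mod_self_right, Nat.add_mul_mod_self_right]
    rw [a1, a2, FF_eq' (n := j) (t := t) _ ht (by omega),
      FF_eq' (n := j + m) (t := t) _ ht (by rw [Nat.add_mul]; omega), heq]
  obtain ⟨κ, rfl⟩ : ∃ κ, k = κ + 2 := ⟨k - 2, by omega⟩
  obtain ⟨K, hK, hK1⟩ : ∃ K, (K = κ + 1 ∧ x + L ≤ D ∨ K = κ ∧ D < x + L) ∧
      x + K * d + M + L ≤ (κ + 2) * d := by
    rcases Nat.lt_or_ge D (x + L) with h | h
    · refine ⟨κ, Or.inr ⟨rfl, h⟩, ?_⟩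
      have : (κ + 2) * d = κ * d + 2 * d := by ring
      omega
    · refine ⟨κ + 1, Or.inl ⟨rfl, h⟩, ?_⟩
      have : (κ + 2) * d = (κ + 1) * d + d := by ring
      omega
  set s0 := x - D with hs0
  set e := D - x with he
  let W' : ℕ → α := fun n => W (n + m * min (K + 1) ((n * L + e - (p + s0)) / D))
  have hD0 : 0 < D := by omega
  have claim : ∀ z c s, s < D → z + e = c * D + s →
      FF G L W' (p + s0 + z) = FF G L W (p + s0 + z + M * min (K + 1) c) := by
    intro z c s hs hz
    obtain ⟨n, t, ht, hn⟩ := split_div hL (p + s0 + z)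
    have hcn : FF G L W' (p + s0 + z) =
        FF G L W (p + s0 + z + M * min (K + 1) ((z + e - t) / D)) := by
      rw [FF_eq' _ ht hn]
      show G (W (n + m * min (K + 1) ((n * L + e - (p + s0)) / D))) t = _
      rw [show n * L + e - (p + s0) = z + e - t by omega]
      symm
      apply FF_eq' _ ht
      rw [hn, ← hM]
      ring
    rw [hcn]
    rcases Nat.lt_or_ge s t with hst | hst
    · rcases Nat.eq_zero_or_pos c with rfl | hc
      · rw [show z + e - t = 0 by omega]
        simp
      · obtain ⟨c, rfl⟩ : ∃ c', c = c' + 1 := ⟨c - 1, by omega⟩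
        have e1 : (c + 1) * D = c * D + D := by ring
        have : (z + e - t) / D = c := by
          rw [Nat.div_eq_iff hD0]
          constructor <;> omega
        rw [this]
        rcases Nat.lt_or_ge K c with hKc | hKc
        · rw [Nat.min_eq_left (by omega), Nat.min_eq_left (by omega)]
        · rw [Nat.min_eq_right (by omega), Nat.min_eq_right (by omega)]
          have e2 : c * d = c * D + M * c := by rw [hD]; ring
          have e3 : M * (c + 1) = M * c + M := by ring
          have e4 : c * d ≤ K * d := Nat.mul_le_mul_right d hKc
          have := E c s (by omega) (by omega)
          rw [show p + (x + c * d + s) = p + s0 + z + M * c by omega,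
            show p + (x + c * d + s + M) = p + s0 + z + M * (c + 1) by omega] at this
          exact this
    · have : (z + e - t) / D = c := by
        rw [Nat.div_eq_iff hD0]
        constructor <;> omega
      rw [this]
  refine ⟨W', p + s0, ?_⟩
  intro y hy hy'
  obtain ⟨z, rfl⟩ : ∃ z, y = p + s0 + z := ⟨y - (p + s0), by omega⟩
  obtain ⟨c, s, hs, hz⟩ := split_div hD0 (z + e)
  have hz2 : z + D < (κ + 2) * D := by omega
  have e1 : (c + 1) * D = c * D + D := by ring
  rw [claim z c s hs hz, Nat.add_assoc (p + s0) z D, claim (z + D) (c + 1) s hs (by omega)]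
  have f1 : (κ + 2) * D = κ * D + 2 * D := by ring
  have f2 : (κ + 2) * d = κ * d + 2 * d := by ring
  have f3 : κ * d = κ * D + M * κ := by rw [hD]; ring
  have f4 : c * d = c * D + M * c := by rw [hD]; ring
  have f5 : M * (c + 1) = M * c + M := by ring
  have hck : c ≤ κ + 1 := by
    by_contra h
    have : (κ + 2) * D ≤ c * D := Nat.mul_le_mul_right D (by omega)
    omega
  rcases Nat.lt_or_ge K c with hKc | hKc
  · -- last, uncut block
    have hKκ : K = κ := by omega
    have hcκ : c = κ + 1 := by omega
    subst hcκ hKκ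
    have g1 : (K + 1) * D = K * D + D := by ring
    have g2 : M * (K + 1) = M * K + M := by ring
    rw [Nat.min_eq_left (by omega), Nat.min_eq_left (by omega)]
    have hx1 := E K s (by omega) (by omega)
    have hx2 := hper (p + (x + K * d + s)) (by omega) (by omega)
    rw [show p + s0 + z + M * (K + 1) = p + (x + K * d + s + M) by omega, ← hx1, hx2]
    congr 1
    omega
  · rw [Nat.min_eq_right (by omega), Nat.min_eq_right (by omega)]
    have hx2 := hper (p + s0 + z + M * c) (by omega) (by
      rcases Nat.lt_or_ge κ c with h | h
      · have hcκ : c = κ + 1 := by omega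
        subst hcκ
        have g1 : (κ + 1) * D = κ * D + D := by ring
        have g2 : M * (κ + 1) = M * κ + M := by ring
        omega
      · have : c * d ≤ κ * d := Nat.mul_le_mul_right d h
        omega)
    rw [hx2]
    congr 1
    omega
end reduction

section main
variable {α γ : Type*} {G : α → ℕ → γ} {L k : ℕ}

/-- minimal bad configuration supported by a power-free word: it belongs to `V` -/
theorem bad_in_V (hk : 3 ≤ k) (hL : 0 < L) (HV : HypV G L k) (W : ℕ → α) (p d n : ℕ)
    (hp : p < L) (hLd : L < d) (hdvd : ¬ L ∣ d)
    (hper : PerOn (FF G L W) p d (k * d))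
    (hn1 : p + k * d ≤ n * L) (hn2 : n * L < p + k * d + L)
    (R : ∀ j m, 1 ≤ m → W j = W (j + m) → p ≤ j * L → (j + m + 1) * L ≤ p + k * d →
      d < (m + 1) * L)
    (hW : PowFr k n W) : False := by
  obtain ⟨κ, rfl⟩ : ∃ κ, k = κ + 1 := ⟨k - 1, by omega⟩
  obtain ⟨q, e, he, hd⟩ := split_div hL d
  have he0 : 0 < e := by
    rcases Nat.eq_zero_or_pos e with h | h
    · exact absurd ⟨q, by rw [hd, h, Nat.mul_comm]; rfl⟩ hdvd
    · exact h
  have hkd : (κ + 1) * d = κ * d + d := by ring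
  have cmp : ∀ a b c, a * L < (b + c) * L → a < b + c := fun a b c h =>
    Nat.lt_of_mul_lt_mul_right h
  -- the index function
  let I : ℕ → ℕ := fun i => if i ≤ κ then (p + i * d) / L else n - 1
  have I1 : ∀ i, i ≤ κ → I i * L ≤ p + i * d ∧ p + i * d < I i * L + L := by
    intro i hi
    have : I i = (p + i * d) / L := by simp [I, hi]
    rw [this]
    constructor
    · exact Nat.div_mul_le_self _ _
    · have := Nat.lt_div_mul_add (a := p + i * d) hL
      omega
  have Ik : I (κ + 1) = n - 1 := by simp [I]
  have hn0 : 1 ≤ n := by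
    by_contra h
    have : n = 0 := by omega
    subst this
    omega
  have hn3 : (n - 1) * L + L = n * L := by
    obtain ⟨n', rfl⟩ : ∃ n', n = n' + 1 := ⟨n - 1, by omega⟩
    simp; ring
  -- weak bounds valid for the next index
  have I2 : ∀ i, i ≤ κ → I (i+1) * L ≤ p + i * d + d ∧ p + i * d + d ≤ I (i+1) * L + L := by
    intro i hi
    rcases Nat.lt_or_ge i κ with h | h
    · have := I1 (i+1) h
      have e : (i+1) * d = i * d + d := by ring
      omega
    · have : i = κ := by omega
      subst this
      rw [Ik]
      omega
  -- differences are q or q + 1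
  have hdiff : ∀ i, i ≤ κ → I i + q ≤ I (i+1) ∧ I (i+1) ≤ I i + q + 1 := by
    intro i hi
    have a := I1 i hi
    have b := I2 i hi
    constructor
    · have : (I i + q) * L < (I (i+1) + 1) * L := by
        rw [Nat.add_mul, Nat.add_mul]; omega
      have := Nat.lt_of_mul_lt_mul_right this
      omega
    · have : I (i+1) * L < (I i + q + 2) * L := by
        have : (I i + q + 2) * L = I i * L + q * L + 2 * L := by ring
        omega
      have := Nat.lt_of_mul_lt_mul_right this
      omega
  have hq : 1 ≤ q := by
    rcases Nat.eq_zero_or_pos q with h | h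
    · subst h; omega
    · exact h
  refine HV W n I ?_ ?_ ?_ ?_ ?_ hW p d (by omega) hn1 hper
  · simp [I, Nat.div_eq_of_lt hp]
  · rw [Ik]; omega
  · intro i hi
    have := hdiff i (by omega)
    omega
  · intro i hi j hj
    have := hdiff i (by omega)
    have := hdiff j (by omega)
    omega
  · intro i hi x y hx hxy hy heq
    have a := I1 i (by omega)
    have b := I2 i (by omega)
    have hx' : (I i + 1) * L ≤ x * L := Nat.mul_le_mul_right L hx
    have hy' : (y + 1) * L ≤ I (i+1) * L := Nat.mul_le_mul_right L hy
    rw [Nat.add_mul, Nat.one_mul] at hx' hy'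
    have hid : i * d ≤ κ * d := Nat.mul_le_mul_right d (by omega)
    obtain ⟨m, rfl⟩ : ∃ m, y = x + m := ⟨y - x, by omega⟩
    have e1 : (x + m) * L = x * L + m * L := by ring
    have := R x m (by omega) heq (by omega) (by rw [Nat.add_mul, Nat.one_mul]; omega)
    rw [Nat.add_mul, Nat.one_mul] at this
    omega

/-- a `k`-power `v^k` in the word, with a long enough overlap -/
theorem bad_overlap (hk : 3 ≤ k) (hL : 0 < L) (HU : HypU G L k) (W : ℕ → α) (p d s m lo hi : ℕ)
    (hLd : L < d) (hdvd : ¬ L ∣ d)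
    (hper : PerOn (FF G L W) p d (k * d))
    (hmin : ∀ d' < d, ∀ (W : ℕ → α) p, L < d' → ¬ L ∣ d' →
      ¬ PerOn (FF G L W) p d' (k * d'))
    (hm : 1 ≤ m) (hv : PerOn W s m (k * m))
    (hmd : m * L < 2 * d)
    (h1 : p ≤ lo) (h2 : s * L ≤ lo) (h3 : hi ≤ p + k * d) (h4 : hi ≤ (s + k * m) * L)
    (h5 : lo + m * L + d ≤ hi) : False := by
  have hML : 0 < m * L := Nat.mul_pos hm hL
  have p1 : PerOn (FF G L W) lo d (hi - lo) := fun z hz hz' => hper z (by omega) (by omega)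
  have p2 : PerOn (FF G L W) lo (m * L) (hi - lo) := by
    intro z hz hz'
    obtain ⟨n, t, ht, rfl⟩ := split_div hL z
    rw [FF_eq _ ht, FF_eq' (n := n + m) _ ht (by ring), hv n]
    · have : s * L < (n + 1) * L := by rw [Nat.add_mul]; omega
      have := Nat.lt_of_mul_lt_mul_right this
      omega
    · have : (n + m) * L < (s + k * m) * L := by rw [Nat.add_mul]; omega
      exact Nat.lt_of_mul_lt_mul_right this
  have p3 := fine_wilf (by omega) p2 p1
  set h := Nat.gcd (m * L) d with hh
  have hhd : h ∣ d := Nat.gcd_dvd_right _ _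
  have hhm : h ∣ m * L := Nat.gcd_dvd_left _ _
  have hh0 : 0 < h := Nat.gcd_pos_of_pos_left _ hML
  have hhle : h ≤ d := Nat.le_of_dvd (by omega) hhd
  have hLh : ¬ L ∣ h := fun h' => hdvd (h'.trans hhd)
  -- the periodic word v^ω
  let V : ℕ → α := fun i => W (s + i % m)
  have Vper : ∀ z, FF G L V z = FF G L V (z % (m * L)) := by
    intro z
    obtain ⟨c, r, hr, rfl⟩ := split_div hML z
    rw [Nat.mul_comm c, Nat.mul_add_mod, Nat.mod_eq_of_lt hr]
    obtain ⟨n, t, ht, rfl⟩ := split_div hL r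
    rw [FF_eq _ ht, FF_eq' (n := m * c + n) _ ht (by ring)]
    simp [V]
  have VW : ∀ z, z < k * m * L → FF G L V z = FF G L W (s * L + z) := by
    intro z hz
    obtain ⟨n, t, ht, rfl⟩ := split_div hL z
    rw [FF_eq _ ht, FF_eq' (n := s + n) _ ht (by ring)]
    have : n * L < k * m * L := by omega
    have hn := Nat.lt_of_mul_lt_mul_right this
    have := per_mod' hv (y := n % m) (y' := n)
      (lt_of_le_of_lt (Nat.mod_le _ _) hn) hn (Nat.mod_mod _ _)
    show G (W (s + n % m)) t = _
    rw [this]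
  have hVh : ∀ z, FF G L V z = FF G L V (z + h) := by
    intro z
    -- choose a representative in the window
    obtain ⟨z', hz1, hz2, hz3⟩ : ∃ z', lo ≤ s * L + z' ∧ s * L + z' < lo + m * L ∧
        z' % (m * L) = z % (m * L) := by
      set o := lo - s * L with ho
      refine ⟨o + (z + (m * L) * o - o) % (m * L), by omega, ?_, ?_⟩
      · have := Nat.mod_lt (z + (m * L) * o - o) hML
        omega
      · rw [Nat.add_mod_mod]
        have : o ≤ m * L * o := Nat.le_mul_of_pos_left _ hML
        rw [show o + (z + m * L * o - o) = z + m * L * o by omega, Nat.add_mul_mod_self_left]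
    have e : (s + k * m) * L = s * L + k * m * L := by ring
    have q1 : FF G L V z = FF G L V z' := by rw [Vper z, Vper z', hz3]
    have q2 : FF G L V (z + h) = FF G L V (z' + h) := by
      rw [Vper (z + h), Vper (z' + h), Nat.add_mod z, Nat.add_mod z', hz3]
    rw [q1, q2, VW z' (by omega), VW (z' + h) (by omega), p3 _ hz1 (by omega)]
    rw [Nat.add_assoc]
  rcases Nat.lt_trichotomy h L with hlt | heq | hgt
  · exact small_period hk hL HU V h hh0 hlt hVh
  · exact hLh (by rw [heq])
  · rcases Nat.eq_or_lt_of_le hhle with h' | h'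
    · rw [h'] at hhm
      obtain ⟨c, hc⟩ := hhm
      have hc1 : c = 1 := by
        rcases c with _ | _ | c
        · omega
        · rfl
        · have : d * (c + 1 + 1) = d * c + 2 * d := by ring
          omega
      subst hc1
      exact hdvd ⟨m, by rw [Nat.mul_comm L, hc]; ring⟩
    · exact hmin h h' V 0 hgt hLh (fun z _ _ => hVh z)

theorem no_bad (hk : 3 ≤ k) (hL : 0 < L) (HU : HypU G L k) (HV : HypV G L k) :
    ∀ d, ∀ (W : ℕ → α) p, L < d → ¬ L ∣ d → ¬ PerOn (FF G L W) p d (k * d) := by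
  intro d
  induction d using Nat.strong_induction_on with
  | _ d ih =>
  intro W0 p0 hLd hdvd hper0
  obtain ⟨j, p, hp, rfl⟩ := split_div hL p0
  obtain ⟨W, hper⟩ : ∃ W : ℕ → α, PerOn (FF G L W) p d (k * d) := by
    refine ⟨fun i => W0 (j + i), fun z hz hz' => ?_⟩
    have := hper0 (j * L + z) (by omega) (by omega)
    rwa [Nat.add_assoc, FF_shift hL, FF_shift hL] at this
  clear hper0
  have R : ∀ j m, 1 ≤ m → W j = W (j + m) → p ≤ j * L → (j + m + 1) * L ≤ p + k * d →
      d < (m + 1) * L := by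
    intro j m hm heq h1 h2
    by_contra hcon
    push Not at hcon
    obtain ⟨W', p', h'⟩ := reduction hk hL W p d j m hper heq h1 h2 hcon
    have hml : 0 < m * L := Nat.mul_pos hm hL
    rw [Nat.add_mul, Nat.one_mul] at hcon
    have hnd : ¬ L ∣ d - m * L := by
      intro h
      apply hdvd
      have := Nat.dvd_add h (Dvd.intro_left m rfl)
      rwa [Nat.sub_add_cancel (by omega)] at this
    have hne : d - m * L ≠ L := fun h => hnd (by rw [h])
    exact ih (d - m * L) (by omega) W' p' (by omega) hnd h'
  obtain ⟨n, hn1, hn2⟩ : ∃ n, p + k * d ≤ n * L ∧ n * L < p + k * d + L := by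
    refine ⟨(p + k * d + L - 1) / L, ?_, ?_⟩
    · have := Nat.lt_div_mul_add (a := p + k * d + L - 1) hL
      omega
    · have := Nat.div_mul_le_self (p + k * d + L - 1) L
      omega
  by_cases hW : PowFr k n W
  · exact bad_in_V hk hL HV W p d n hp hLd hdvd hper hn1 hn2 R hW
  unfold PowFr at hW
  push Not at hW
  obtain ⟨s, m, hm, hsn, hv⟩ := hW
  have hkd3 : 3 * d ≤ k * d := Nat.mul_le_mul_right d hk
  have hn4 : 4 ≤ n := by
    by_contra h
    have : n * L ≤ 3 * L := Nat.mul_le_mul_right L (by omega)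
    omega
  have hWm : ∀ i, s ≤ i → i + m < s + k * m → W i = W (i + m) := hv
  -- letters strictly inside
  have inside : ∀ j m, 1 ≤ j → j + m + 2 ≤ n → p ≤ j * L ∧ (j + m + 1) * L ≤ p + k * d := by
    intro j m h1 h2
    have a : 1 * L ≤ j * L := Nat.mul_le_mul_right L h1
    have b : (j + m + 2) * L ≤ n * L := Nat.mul_le_mul_right L h2
    have e : (j + m + 2) * L = (j + m + 1) * L + L := by ring
    omega
  have bound : d < (m + 1) * L := by
    by_cases hspec : k = 3 ∧ m = 1
    · obtain ⟨rfl, rfl⟩ := hspec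
      rcases Nat.eq_zero_or_pos s with h | h
      · have := inside 1 1 (by omega) (by omega)
        exact R 1 1 le_rfl (hWm 1 (by omega) (by omega)) this.1 this.2
      · have := inside s 1 (by omega) (by omega)
        exact R s 1 le_rfl (hWm s (by omega) (by omega)) this.1 this.2
    · have h3 : m + 3 ≤ k * m := by
        rcases Nat.lt_or_ge 3 k with h | h
        · have : 4 * m ≤ k * m := Nat.mul_le_mul_right m h
          omega
        · have : k = 3 := by omega
          subst this
          omega
      have := inside (s+1) m (by omega) (by omega)
      exact R (s+1) m hm (hWm (s+1) (by omega) (by omega)) this.1 this.2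
  have b' : (m + 1) * L = m * L + L := by ring
  have eL : (s + k * m) * L = s * L + k * m * L := by ring
  have hsnL : (s + k * m) * L ≤ n * L := Nat.mul_le_mul_right L hsn
  have hkm3 : 3 * (m * L) ≤ k * (m * L) := Nat.mul_le_mul_right _ hk
  have hkmL : k * (m * L) = k * m * L := by ring
  -- `m * L < 2 * d`
  have hmd : m * L < 2 * d := by
    by_contra hcon
    push Not at hcon
    have c1 : k * (2 * d) ≤ k * (m * L) := Nat.mul_le_mul_left k hcon
    have c2 : k * (2 * d) = 2 * (k * d) := by ring
    -- k m L ≤ n L < k d + 2 L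
    omega
  have fin : ∀ lo hi, p ≤ lo → s * L ≤ lo → hi ≤ p + k * d → hi ≤ (s + k * m) * L →
      lo + m * L + d ≤ hi → False := fun lo hi h1 h2 h3 h4 h5 =>
    bad_overlap hk hL HU W p d s m lo hi hLd hdvd hper ih hm hv hmd h1 h2 h3 h4 h5
  by_cases hspec : k = 3 ∧ m = 1
  · obtain ⟨rfl, rfl⟩ := hspec
    obtain ⟨e, rfl⟩ : ∃ e, d = L + e := ⟨d - L, by omega⟩
    have w1 : W (s + 1) = W s := (hWm s le_rfl (by omega)).symm
    have w2 : W (s + 2) = W s := by rw [← w1]; exact (hWm (s+1) (by omega) (by omega)).symm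
    rcases Nat.eq_zero_or_pos s with h | h
    · subst h
      have h4L : 4 * L ≤ n * L := Nat.mul_le_mul_right L hn4
      rcases Nat.lt_or_ge (2 * L) (p + (L + e)) with h' | h'
      · exact special_start hL HU W p e (by simpa using w1) (by simpa using w2) hp
          (by omega) (by omega) (by omega) hper
      · exact fin p (3 * L) le_rfl (by omega) (by omega) (by omega) (by omega)
    · have hsL : 1 * L ≤ s * L := Nat.mul_le_mul_right L h
      rcases Nat.lt_or_ge (s + 3) n with h' | h'
      · have : (s + 3 + 1) * L ≤ n * L := Nat.mul_le_mul_right L h'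
        have e4 : (s + 3 + 1) * L = s * L + 4 * L := by ring
        exact fin (s * L) (s * L + 3 * L) (by omega) le_rfl (by omega) (by omega) (by omega)
      · have hns : n = s + 3 := by omega
        subst hns
        have e3 : (s + 3) * L = s * L + 3 * L := by ring
        have e2 : (s + 2) * L = s * L + 2 * L := by ring
        have e1 : (s + 1) * L = s * L + L := by ring
        rcases Nat.lt_or_ge (p + 2 * (L + e)) ((s + 1) * L) with hcut | hcut
        · exact special_end hL HU W p e s w1 w2 hn1 (by omega) (by omega) (by omega) hcut hper
        · exact fin (s * L) (p + 3 * (L + e)) (by omega) le_rfl (by omega) (by omega) (by omega)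
  · have h2 : 2 * m + 2 ≤ k * m := by
      rcases Nat.lt_or_ge 3 k with h | h
      · have : 4 * m ≤ k * m := Nat.mul_le_mul_right m h
        omega
      · have : k = 3 := by omega
        subst this
        omega
    have h2L : (2 * m + 2) * L ≤ k * m * L := Nat.mul_le_mul_right L h2
    have e2 : (2 * m + 2) * L = 2 * (m * L) + 2 * L := by ring
    rcases Nat.eq_zero_or_pos s with h | h
    · subst h
      rcases Nat.lt_or_ge (k * m) n with h' | h'
      · have : (k * m + 1) * L ≤ n * L := Nat.mul_le_mul_right L h'
        have e4 : (k * m + 1) * L = k * m * L + L := by ring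
        exact fin p (k * m * L) le_rfl (by omega) (by omega) (by omega) (by omega)
      · have hnk : n = k * m := by omega
        subst hnk
        refine fin p (p + k * d) le_rfl (by omega) le_rfl (by omega) ?_
        by_contra hcon
        omega
    · have hsL : 1 * L ≤ s * L := Nat.mul_le_mul_right L h
      refine fin (s * L) (min (p + k * d) ((s + k * m) * L)) (by omega) le_rfl
        (Nat.min_le_left _ _) (Nat.min_le_right _ _) ?_
      omega

theorem main_fun [Nontrivial α] (hk : 3 ≤ k) (hL : 0 < L) (HU : HypU G L k) (HV : HypV G L k)
    (W : ℕ → α) (n : ℕ) (hW : PowFr k n W) : PowFr k (n * L) (FF G L W) := by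
  intro p d hd hp hper
  by_cases hdvd : L ∣ d
  · obtain ⟨q, rfl⟩ := hdvd
    rw [Nat.mul_comm L q] at *
    refine mult_case hk hL HU W n p q ?_ hW hp hper
    rcases Nat.eq_zero_or_pos q with h | h
    · subst h; omega
    · exact h
  · rcases Nat.lt_trichotomy d L with h | h | h
    · exact short_case hL HU W n p d hd h hW hp hper
    · exact hdvd (by rw [h])
    · exact no_bad hk hL HU HV d W p h hdvd hper
end main

section bridge

theorem flatMap_len {α β : Type*} (g : α → List β) (L : ℕ) (l : List α)
    (h : ∀ a ∈ l, (g a).length = L) : (l.flatMap g).length = l.length * L := by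
  induction l with
  | nil => simp
  | cons a l ih =>
    rw [List.flatMap_cons, List.length_append, h a (by simp),
      ih (fun b hb => h b (by simp [hb])), List.length_cons, Nat.add_mul]
    omega

theorem flatMap_get {α β : Type*} (g : α → List β) (L : ℕ) (hL : 0 < L) (l : List α)
    (h : ∀ a ∈ l, (g a).length = L) (z : ℕ) :
    (l.flatMap g)[z]? = (l[z / L]?).bind (fun a => (g a)[z % L]?) := by
  induction l generalizing z with
  | nil => simp
  | cons a l ih =>
    rw [List.flatMap_cons]
    have ha := h a (by simp)
    by_cases hz : z < L
    · rw [List.getElem?_append_left (by omega), Nat.div_eq_of_lt hz, Nat.mod_eq_of_lt hz]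
      simp
    · rw [List.getElem?_append_right (by omega), ih (fun b hb => h b (by simp [hb])), ha]
      have e1 : z / L = (z - L) / L + 1 := by
        rw [← Nat.add_div_right _ hL]; congr 1; omega
      have e2 : (z - L) % L = z % L := (Nat.mod_eq_sub_mod (by omega)).symm
      rw [e1, e2, List.getElem?_cons_succ]

theorem wpow_len {α : Type*} (u : List α) (k : ℕ) : (wpow u k).length = k * u.length := by
  unfold wpow
  simp

theorem wpow_get {α : Type*} (u : List α) (k : ℕ) (hu : 0 < u.length) (z : ℕ)
    (hz : z < k * u.length) : (wpow u k)[z]? = u[z % u.length]? := by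
  unfold wpow
  have := flatMap_get (id : List α → List α) u.length hu (List.replicate k u)
    (by intro a ha; rw [(List.mem_replicate.1 ha).2]; rfl) z
  rw [List.flatMap_id] at this
  rw [this, List.getElem?_replicate, if_pos ((Nat.div_lt_iff_lt_mul hu).2 hz)]
  rfl

theorem per_iter {γ : Type*} {s : ℕ → γ} {p d l : ℕ} (h : PerOn s p d l) :
    ∀ q t, q * d + t < l → s (p + (q * d + t)) = s (p + t) := by
  intro q
  induction q with
  | zero => intro t _; simp
  | succ q ih =>
    intro t ht
    rw [Nat.add_mul] at ht
    have := h (p + (q * d + t)) (by omega) (by omega)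
    rw [← ih t (by omega), this]
    congr 1
    rw [Nat.add_mul]; omega

theorem kpf_iff {α : Type*} (k : ℕ) (hk : 1 ≤ k) (l : List α) :
    kPowerFree k l ↔ PowFr k l.length (fun i => l[i]?) := by
  constructor
  · intro h p d hd hp hper
    have hdk : d ≤ k * d := Nat.le_mul_of_pos_left d hk
    have hul : ((l.drop p).take d).length = d := by
      rw [List.length_take, List.length_drop]; omega
    refine h ((l.drop p).take d) ?_ ?_
    · intro h0
      rw [h0] at hul
      simp at hul; omega
    · have : wpow ((l.drop p).take d) k = (l.drop p).take (k * d) := by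
        apply List.ext_getElem?
        intro z
        by_cases hz : z < k * d
        · rw [wpow_get _ _ (by omega) _ (by rw [hul]; exact hz), hul,
            List.getElem?_take_of_lt (Nat.mod_lt _ hd), List.getElem?_take_of_lt hz,
            List.getElem?_drop, List.getElem?_drop]
          have e : z / d * d + z % d = z := Nat.div_add_mod' z d
          have := per_iter hper (z / d) (z % d) (by omega)
          rw [e] at this
          exact this.symm
        · rw [List.getElem?_eq_none (by rw [wpow_len, hul]; omega),
            List.getElem?_eq_none (by rw [List.length_take]; omega)]
      rw [this]
      exact ⟨l.take p, (l.drop p).drop (k * d), by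
        rw [List.append_assoc, List.take_append_drop, List.take_append_drop]⟩
  · rintro h u hu ⟨s, t, rfl⟩
    have hu' : 0 < u.length := List.length_pos_iff.2 hu
    refine h s.length u.length hu' ?_ ?_
    · simp only [List.length_append, wpow_len]; omega
    · intro z hz1 hz2
      have key : ∀ y, s.length ≤ y → y < s.length + k * u.length →
          (s ++ wpow u k ++ t)[y]? = u[(y - s.length) % u.length]? := by
        intro y h1 h2
        rw [List.getElem?_append_left (by rw [List.length_append, wpow_len]; omega),
          List.getElem?_append_right h1, wpow_get _ _ hu' _ (by omega)]
      show (s ++ wpow u k ++ t)[z]? = (s ++ wpow u k ++ t)[z + u.length]?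
      rw [key z hz1 (by omega), key _ (by omega) hz2]
      have : z + u.length - s.length = z - s.length + u.length := by omega
      rw [this, Nat.add_mod_right]

theorem kpf_word {α : Type*} (k : ℕ) (hk : 1 ≤ k) (W : ℕ → α) (n : ℕ) :
    kPowerFree k ((List.range n).map W) ↔ PowFr k n W := by
  rw [kpf_iff k hk, List.length_map, List.length_range]
  have e : ∀ i, i < n → ((List.range n).map W)[i]? = some (W i) := by
    intro i hi
    simp [hi]
  constructor
  · intro h
    refine PowFr_congr ?_ h
    intro i j hi hj hij
    show ((List.range n).map W)[i]? = ((List.range n).map W)[j]?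
    rw [e i hi, e j hj, hij]
  · intro h
    refine PowFr_congr ?_ h
    intro i j hi hj hij
    have hij : ((List.range n).map W)[i]? = ((List.range n).map W)[j]? := hij
    rw [e i hi, e j hj] at hij
    exact Option.some.inj hij

theorem kpf_image {α β : Type*} (k : ℕ) (hk : 1 ≤ k) (g : α → List β) (L : ℕ) (hL : 0 < L)
    (hg : ∀ a, (g a).length = L) (W : ℕ → α) (n : ℕ) :
    kPowerFree k (applyMorph g ((List.range n).map W)) ↔
      PowFr k (n * L) (FF (fun a t => (g a)[t]?) L W) := by
  have hlen : (applyMorph g ((List.range n).map W)).length = n * L := by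
    unfold applyMorph
    rw [flatMap_len g L _ (fun a _ => hg a), List.length_map, List.length_range]
  rw [kpf_iff k hk, hlen]
  have e : ∀ z, z < n * L → (applyMorph g ((List.range n).map W))[z]? =
      FF (fun a t => (g a)[t]?) L W z := by
    intro z hz
    have hz' : z / L < n := (Nat.div_lt_iff_lt_mul hL).2 hz
    unfold applyMorph FF
    rw [flatMap_get g L hL _ (fun a _ => hg a)]
    simp [hz']
  constructor
  · intro h
    refine PowFr_congr ?_ h
    intro i j hi hj hij
    show (applyMorph g ((List.range n).map W))[i]? = (applyMorph g ((List.range n).map W))[j]?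
    rw [e i hi, e j hj, hij]
  · intro h
    refine PowFr_congr ?_ h
    intro i j hi hj hij
    have hij : (applyMorph g ((List.range n).map W))[i]? =
      (applyMorph g ((List.range n).map W))[j]? := hij
    rw [e i hi, e j hj] at hij
    exact hij

theorem decomp_word {α : Type*} (W : ℕ → α) (I : ℕ → ℕ) (h0 : I 0 = 0) (k : ℕ)
    (hI : ∀ i < k, I i < I (i+1)) :
    (List.range (I k + 1)).map W = [W (I 0)] ++ (List.range k).flatMap (fun i =>
      (List.range (I (i+1) - I i - 1)).map (fun t => W (I i + 1 + t)) ++ [W (I (i+1))]) := by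
  induction k with
  | zero => simp [h0]
  | succ k ih =>
    rw [List.range_succ (n := k), List.flatMap_append, ← List.append_assoc,
      ← ih (fun i hi => hI i (by omega))]
    have h := hI k (by omega)
    have e : I (k+1) + 1 = (I k + 1) + (I (k+1) - I k - 1) + 1 := by omega
    rw [e, List.range_succ, List.map_append, List.range_add, List.map_append, List.map_map,
      List.append_assoc]
    have e2 : I k + 1 + (I (k+1) - I k - 1) = I (k+1) := by omega
    simp [e2, Function.comp_def]

theorem V_word {α : Type*} [DecidableEq α] (k : ℕ) (W : ℕ → α) (I : ℕ → ℕ) (h0 : I 0 = 0)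
    (hI : ∀ i < k, I i < I (i+1))
    (hb : ∀ i < k, ∀ j < k, I (i+1) + I j ≤ I (j+1) + I i + 1)
    (hd : ∀ i < k, ∀ x y, I i < x → x < y → y < I (i+1) → W x ≠ W y) :
    memV k ((List.range (I k + 1)).map W) := by
  refine ⟨fun i => W (I i),
    fun i => (List.range (I i - I (i-1) - 1)).map (fun t => W (I (i-1) + 1 + t)), ?_, ?_, ?_⟩
  · exact decomp_word W I h0 k hI
  · intro i j hi1 hi2 hj1 hj2
    obtain ⟨i, rfl⟩ : ∃ i', i = i' + 1 := ⟨i - 1, by omega⟩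
    obtain ⟨j, rfl⟩ : ∃ j', j = j' + 1 := ⟨j - 1, by omega⟩
    have := hb i (by omega) j (by omega)
    have := hI i (by omega)
    have := hI j (by omega)
    simp only [List.length_map, List.length_range, Nat.add_sub_cancel]
    omega
  · intro i hi1 hi2
    obtain ⟨i, rfl⟩ : ∃ i', i = i' + 1 := ⟨i - 1, by omega⟩
    apply List.nodup_iff_count_le_one.1
    simp only [Nat.add_sub_cancel]
    refine List.Nodup.map_on ?_ List.nodup_range
    intro x hx y hy hxy
    rw [List.mem_range] at hx hy
    rcases Nat.lt_trichotomy x y with h | h | h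
    · exact absurd hxy (hd i (by omega) _ _ (by omega) (by omega) (by omega))
    · exact h
    · exact absurd hxy.symm (hd i (by omega) _ _ (by omega) (by omega) (by omega))

end bridge

theorem test_set_uniform {α β : Type*} [Fintype α] [DecidableEq α]
    (hA : 2 ≤ Fintype.card α) (k : ℕ) (hk : 3 ≤ k)
    (g : α → List β) (L : ℕ) (huniform : ∀ a : α, (g a).length = L) :
    (∀ w : List α, kPowerFree k w → kPowerFree k (applyMorph g w)) ↔
    (∀ w : List α, memT k w → kPowerFree k (applyMorph g w)) := by
  constructor
  · rintro h w (hw | hw)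
    · exact h w hw.1
    · exact h w hw.1
  · intro h w hw
    have hk1 : 1 ≤ k := by omega
    rcases Nat.eq_zero_or_pos L with hL | hL
    · subst hL
      have hlen : (applyMorph g w).length = 0 := by
        unfold applyMorph
        rw [flatMap_len g 0 w (fun a _ => huniform a)]; rfl
      rw [kpf_iff k hk1, hlen]
      intro p d hd hp
      have : 0 < k * d := Nat.mul_pos (by omega) (by omega)
      omega
    · have : Nontrivial α := Fintype.one_lt_card_iff_nontrivial.1 hA
      obtain ⟨a0⟩ : Nonempty α := inferInstance
      have HU : HypU (fun a t => (g a)[t]?) L k := by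
        intro W n hn hW
        rw [← kpf_image k hk1 g L hL huniform]
        refine h _ (Or.inl ⟨(kpf_word k hk1 W n).2 hW, ?_⟩)
        simpa using hn
      have HV : HypV (fun a t => (g a)[t]?) L k := by
        intro W n I h0 hn hI hb hd hW
        rw [← kpf_image k hk1 g L hL huniform]
        refine h _ (Or.inr ⟨(kpf_word k hk1 W n).2 hW, ?_⟩)
        rw [← hn]
        exact V_word k W I h0 hI hb hd
      have ew : w = (List.range w.length).map (fun i => w.getD i a0) := by
        apply List.ext_getElem
        · simp
        · intro i h1 h2
          simp [h1]
      rw [ew] at hw ⊢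
      rw [kpf_image k hk1 g L hL huniform]
      exact main_fun hk hL HU HV _ _ ((kpf_word k hk1 _ _).1 hw)
end

section
/- Let k ≥ 3 and A be a finite alphabet. A uniform morphism f on A is k-power-free if and only if the images under f of all k-power-free words of length at most k·|A| + k + 1 are k-power-free. -/
namespace TB

/-- `F` has period `p` on the interval `[a, b)`. -/
def Per {γ : Type*} (F : ℕ → γ) (p a b : ℕ) : Prop := ∀ x, a ≤ x → x + p < b → F x = F (x + p)

lemma wpow_zero' {γ : Type*} (u : List γ) : wpow u 0 = [] := by simp [wpow]

lemma wpow_succ' {γ : Type*} (u : List γ) (n : ℕ) : wpow u (n + 1) = u ++ wpow u n := by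
  simp [wpow, List.replicate_succ]

lemma wpow_length {γ : Type*} (u : List γ) (n : ℕ) : (wpow u n).length = n * u.length := by
  simp [wpow]

lemma wpow_get {γ : Type*} (u : List γ) (n x : ℕ) (hx : x < n * u.length) :
    (wpow u n)[x]? = u[x % u.length]? := by
  induction n generalizing x with
  | zero => simp at hx
  | succ n ih =>
    rw [wpow_succ']
    by_cases h : x < u.length
    · rw [List.getElem?_append_left h, Nat.mod_eq_of_lt h]
    · push Not at h
      rw [List.getElem?_append_right h, ih]
      · rw [Nat.mod_eq_sub_mod h]
      · rw [Nat.succ_mul] at hx; omega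

lemma infix_iff {γ : Type*} (l z : List γ) :
    l <:+: z ↔ ∃ a, a + l.length ≤ z.length ∧ ∀ x < l.length, z[a + x]? = l[x]? := by
  constructor
  · rintro ⟨X, Y, rfl⟩
    refine ⟨X.length, by simp, fun x hx => ?_⟩
    rw [List.append_assoc, List.getElem?_append_right (by omega), List.getElem?_append_left (by omega)]
    congr 1; omega
  · rintro ⟨a, ha, h⟩
    have : l = (z.drop a).take l.length := by
      apply List.ext_getElem?
      intro i
      by_cases hi : i < l.length
      · rw [List.getElem?_take_of_lt hi, List.getElem?_drop, h i hi]
      · rw [List.getElem?_eq_none (by omega), List.getElem?_eq_none (by simp; omega)]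
    rw [this]
    exact (List.take_prefix _ _).isInfix.trans (List.drop_suffix _ _).isInfix

lemma per_mod {γ : Type*} (F : ℕ → γ) (p a b : ℕ) (hp : 0 < p) (h : Per F p a b) (x : ℕ)
    (hx : a + x < b) : F (a + x) = F (a + x % p) := by
  induction x using Nat.strong_induction_on with
  | _ x ih =>
    by_cases hxp : x < p
    · rw [Nat.mod_eq_of_lt hxp]
    · push Not at hxp
      rw [Nat.mod_eq_sub_mod hxp, ← ih (x - p) (by omega) (by omega), h (a + (x - p)) (by omega) (by omega)]
      congr 1; omega

lemma kpf_iff {γ : Type*} (k : ℕ) (hk : 1 ≤ k) (z : List γ) :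
    kPowerFree k z ↔
      ∀ p, 1 ≤ p → ∀ a, a + k * p ≤ z.length → ¬ Per (fun x => z[x]?) p a (a + k * p) := by
  constructor
  · intro h p hp a ha hper
    have hpk : p ≤ k * p := Nat.le_mul_of_pos_left _ hk
    have hl : ((z.drop a).take p).length = p := by simp; omega
    refine h ((z.drop a).take p) (fun h0 => by rw [h0] at hl; simp at hl; omega) ?_
    rw [infix_iff]
    refine ⟨a, by rw [wpow_length, hl]; exact ha, fun x hx => ?_⟩
    rw [wpow_length] at hx
    rw [wpow_get _ _ _ hx, hl]
    rw [hl] at hx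
    rw [List.getElem?_take_of_lt (Nat.mod_lt _ hp), List.getElem?_drop]
    exact per_mod (fun x => z[x]?) p a _ hp hper x (by omega)
  · intro h u hu hin
    rw [infix_iff] at hin
    obtain ⟨a, ha, hx⟩ := hin
    rw [wpow_length] at ha hx
    have hu' : 1 ≤ u.length := List.length_pos_iff.2 hu
    refine h u.length hu' a ha ?_
    intro x h1 h2
    have e1 := hx (x - a) (by omega)
    have e2 := hx (x - a + u.length) (by omega)
    rw [wpow_get _ _ _ (by omega)] at e1 e2
    rw [Nat.add_mod_right] at e2
    rw [← e1] at e2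
    show z[x]? = z[x + u.length]?
    rw [show x = a + (x - a) by omega, ← e2]
    congr 1; omega

/-- weak Fine and Wilf theorem -/
lemma fw {γ : Type*} (F : ℕ → γ) (a b : ℕ) : ∀ n p q, p + q ≤ n → a + p + q ≤ b →
    Per F p a b → Per F q a b → Per F (Nat.gcd p q) a b := by
  intro n
  induction n with
  | zero =>
    intro p q h _ hp _
    have : p = 0 := by omega
    have : q = 0 := by omega
    subst p; subst q
    simpa using hp
  | succ n ih =>
    have key : ∀ p q, p ≤ q → 0 < p → p + q ≤ n + 1 → a + p + q ≤ b →
        Per F p a b → Per F q a b → Per F (Nat.gcd p q) a b := by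
      intro p q hpq hp0 h hb hp hq
      have h3 : Per F (q - p) a b := by
        intro x hx1 hx2
        by_cases hc : x + q < b
        · rw [hq x hx1 hc, hp (x + (q - p)) (by omega) (by omega)]
          congr 1; omega
        · have e1 := hp (x - p) (by omega) (by omega)
          have e2 := hq (x - p) (by omega) (by omega)
          rw [show x - p + p = x by omega] at e1
          rw [← e1, e2]; congr 1; omega
      have := ih p (q - p) (by omega) (by omega) hp h3
      rwa [Nat.gcd_sub_self_right hpq] at this
    intro p q h hb hp hq
    by_cases hp0 : p = 0
    · subst hp0; simpa using hq
    by_cases hq0 : q = 0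
    · subst hq0; simpa using hp
    rcases le_total p q with hpq | hpq
    · exact key p q hpq (by omega) h hb hp hq
    · rw [Nat.gcd_comm]
      exact key q p hpq (by omega) (by omega) (by omega) hq hp


lemma len_f {α β : Type*} (g : α → List β) (L : ℕ) (hu : ∀ a : α, (g a).length = L) (W : List α) : (applyMorph g W).length = W.length * L := by
  induction W with
  | nil => simp [applyMorph]
  | cons a W ih =>
    simp only [applyMorph, List.flatMap_cons, List.length_append, List.length_cons, hu] at ih ⊢
    rw [ih]; ring

lemma f_append {α β : Type*} (g : α → List β) (W V : List α) : applyMorph g (W ++ V) = applyMorph g W ++ applyMorph g V := by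
  simp [applyMorph]

lemma f_take {α β : Type*} (g : α → List β) (L : ℕ) (hu : ∀ a : α, (g a).length = L) (W : List α) (n : ℕ) : applyMorph g (W.take n) = (applyMorph g W).take (n * L) := by
  by_cases hn : n ≤ W.length
  · conv_rhs => rw [← List.take_append_drop n W, f_append g]
    rw [List.take_left']
    rw [len_f g L hu]; simp [hn]
  · push Not at hn
    rw [List.take_of_length_le hn.le, List.take_of_length_le]
    rw [len_f g L hu]; exact Nat.mul_le_mul_right _ hn.le

lemma f_drop {α β : Type*} (g : α → List β) (L : ℕ) (hu : ∀ a : α, (g a).length = L) (W : List α) (n : ℕ) : applyMorph g (W.drop n) = (applyMorph g W).drop (n * L) := by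
  by_cases hn : n ≤ W.length
  · conv_rhs => rw [← List.take_append_drop n W, f_append g]
    rw [List.drop_left']
    rw [len_f g L hu]; simp [hn]
  · push Not at hn
    rw [List.drop_of_length_le hn.le, List.drop_of_length_le]
    · simp [applyMorph]
    rw [len_f g L hu]; exact Nat.mul_le_mul_right _ hn.le

lemma f_get {α β : Type*} (g : α → List β) (L : ℕ) (hu : ∀ a : α, (g a).length = L) (hL : 0 < L) (W : List α) (x : ℕ) :
    (applyMorph g W)[x]? = (W[x / L]?).bind (fun a => (g a)[x % L]?) := by
  induction W generalizing x with
  | nil => simp [applyMorph]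
  | cons a W ih =>
    have : applyMorph g (a :: W) = g a ++ applyMorph g W := by simp [applyMorph]
    rw [this]
    by_cases h : x < L
    · rw [List.getElem?_append_left (by rw [hu]; exact h), Nat.div_eq_of_lt h, Nat.mod_eq_of_lt h]
      simp
    · push Not at h
      rw [List.getElem?_append_right (by rw [hu]; exact h), hu, ih]
      obtain ⟨y, rfl⟩ := Nat.exists_eq_add_of_le h
      rw [Nat.add_sub_cancel_left, Nat.add_mod_left, Nat.add_div_left _ hL]
      simp


end TB

namespace TB

/-- standing assumptions -/
structure Ctx {α β : Type*} (k : ℕ) (g : α → List β) (L B : ℕ) : Prop where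
  hk : 3 ≤ k
  hu : ∀ a : α, (g a).length = L
  hL : 0 < L
  H : ∀ w : List α, w.length ≤ B → kPowerFree k w → kPowerFree k (applyMorph g w)
  hB : 2 * k + 1 ≤ B

/-- the image of `W` as a function on positions -/
def T {α β : Type*} (g : α → List β) (W : List α) (x : ℕ) : Option β := (applyMorph g W)[x]?

lemma T_blk {α β : Type*} {k L B : ℕ} {g : α → List β} (C : Ctx k g L B) (W : List α) (i r : ℕ) (hr : r < L) :
    T g W (i * L + r) = (W[i]?).bind (fun a => (g a)[r]?) := by
  have hL := C.hL
  rw [T, f_get g L C.hu C.hL]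
  rw [show (i * L + r) / L = i by
    rw [Nat.add_comm, Nat.add_mul_div_right _ _ hL, Nat.div_eq_of_lt hr]; omega,
    show (i * L + r) % L = r by
      rw [Nat.add_comm, Nat.add_mul_mod_self_right, Nat.mod_eq_of_lt hr]]

/-- no k-power at index level in short images -/
lemma Ctx.noPer {α β : Type*} {k L B : ℕ} {g : α → List β} (C : Ctx k g L B) (W : List α) (hW : W.length ≤ B)
    (hf : kPowerFree k W) (p : ℕ) (hp : 1 ≤ p) (a : ℕ) (ha : a + k * p ≤ W.length * L) :
    ¬ Per (T g W) p a (a + k * p) := by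
  have := C.hk
  exact (kpf_iff k (by omega) _).1 (C.H W hW hf) p hp a (by rw [len_f g L C.hu]; exact ha)

lemma Ctx.inj {α β : Type*} {k L B : ℕ} {g : α → List β} (C : Ctx k g L B) (a b : α) (h : g a = g b) : a = b := by
  by_contra hab
  have hk := C.hk
  have hL := C.hL
  have hB := C.hB
  have hlen : (List.replicate (k - 1) a ++ [b]).length = k := by simp; omega
  refine C.noPer (List.replicate (k - 1) a ++ [b]) (by omega) ?_ L hL 0 (by rw [hlen]; omega) ?_
  · rw [kpf_iff k (by omega)]
    intro p hp s hs hper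
    rw [hlen] at hs
    have hp1 : p = 1 := by
      by_contra hne
      have : k * 2 ≤ k * p := Nat.mul_le_mul_left _ (by omega)
      omega
    subst hp1
    have := hper (k - 2) (by omega) (by omega)
    simp only at this
    rw [List.getElem?_append_left (by simp; omega), List.getElem?_append_right (by simp; omega)] at this
    have e : k - 2 + 1 - (k - 1) = 0 := by omega
    simp [List.getElem?_replicate, e] at this
    exact hab this.2
  · have key : ∀ i < k, ∀ r < L, T g (List.replicate (k - 1) a ++ [b]) (i * L + r) = (g a)[r]? := by
      intro i hi r hr
      rw [T_blk C _ _ _ hr]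
      by_cases hik : i < k - 1
      · rw [List.getElem?_append_left (by simpa using hik)]
        simp [List.getElem?_replicate, hik]
      · rw [List.getElem?_append_right (by simp; omega)]
        have e : i - (k - 1) = 0 := by omega
        simp [e, h]
    intro x _ hx
    have hd := Nat.div_add_mod x L
    have hm := Nat.mod_lt x hL
    rw [Nat.mul_comm] at hd
    have hq : x / L + 1 < k := by
      have h2 : (x + L) / L < k := by rw [Nat.div_lt_iff_lt_mul hL]; omega
      rwa [Nat.add_div_right _ hL] at h2
    rw [← hd, key _ (by omega) _ hm]
    rw [show x / L * L + x % L + L = (x / L + 1) * L + x % L by ring, key _ hq _ hm]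

lemma blk_eq {α β : Type*} {k L B : ℕ} {g : α → List β} (C : Ctx k g L B) (W V : List α) (i j : ℕ)
    (hi : i < W.length) (hj : j < V.length)
    (h : ∀ r < L, T g W (i * L + r) = T g V (j * L + r)) : W[i]? = V[j]? := by
  rw [List.getElem?_eq_getElem hi, List.getElem?_eq_getElem hj]
  congr 1
  apply C.inj
  apply List.ext_getElem?
  intro r
  by_cases hr : r < L
  · have := h r hr
    rw [T_blk C _ _ _ hr, T_blk C _ _ _ hr, List.getElem?_eq_getElem hi, List.getElem?_eq_getElem hj] at this
    simpa using this
  · rw [List.getElem?_eq_none (by rw [C.hu]; omega), List.getElem?_eq_none (by rw [C.hu]; omega)]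

/-- no period which is a multiple of `L` -/
lemma case1 {α β : Type*} {k L B : ℕ} {g : α → List β} (C : Ctx k g L B) (W : List α) (hf : kPowerFree k W)
    (e s : ℕ) (he : 1 ≤ e) (hs : s + k * (e * L) ≤ W.length * L) :
    ¬ Per (T g W) (e * L) s (s + k * (e * L)) := by
  intro hper
  have hk := C.hk
  have hL := C.hL
  have hB := C.hB
  have hf' := (kpf_iff k (by omega) W).1 hf
  obtain ⟨q, r, hr, rfl⟩ : ∃ q r, r < L ∧ s = q * L + r :=
    ⟨s / L, s % L, Nat.mod_lt _ hL, by rw [Nat.mul_comm]; exact (Nat.div_add_mod s L).symm⟩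
  have hke : e ≤ k * e := Nat.le_mul_of_pos_left _ (by omega)
  have hlen : q + k * e ≤ W.length := by
    by_contra hc
    have : (W.length + 1) * L ≤ (q + k * e) * L := Nat.mul_le_mul_right _ (by omega)
    have e1 : (q + k * e) * L = q * L + k * (e * L) := by ring
    have e2 : (W.length + 1) * L = W.length * L + L := by ring
    omega
  have blk : ∀ i, q * L + r ≤ i * L → (i + e + 1) * L ≤ q * L + r + k * (e * L) →
      i + e < W.length → W[i]? = W[i + e]? := by
    intro i h1 h2 h3
    apply blk_eq C _ _ _ _ (by omega) h3
    intro x hx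
    have e2 : (i + e + 1) * L = i * L + e * L + L := by ring
    have e3 : (i + e) * L = i * L + e * L := by ring
    rw [hper (i * L + x) (by omega) (by omega)]
    congr 1; omega
  by_cases hr0 : r = 0
  · subst hr0
    refine hf' e he q hlen ?_
    intro i h1 h2
    apply blk i
    · have := Nat.mul_le_mul_right L h1; omega
    · have := Nat.mul_le_mul_right L (show i + e + 1 ≤ q + k * e by omega)
      have e1 : (q + k * e) * L = q * L + k * (e * L) := by ring
      omega
    · omega
  have hlen1 : q + k * e < W.length := by
    by_contra hc
    have : W.length * L ≤ (q + k * e) * L := Nat.mul_le_mul_right _ (by omega)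
    have e1 : (q + k * e) * L = q * L + k * (e * L) := by ring
    omega
  have hpW : Per (fun x => W[x]?) e (q + 1) (q + k * e) := by
    intro i h1 h2
    apply blk i
    · have := Nat.mul_le_mul_right L h1
      have e2 : (q + 1) * L = q * L + L := by ring
      omega
    · have := Nat.mul_le_mul_right L (show i + e + 1 ≤ q + k * e by omega)
      have e1 : (q + k * e) * L = q * L + k * (e * L) := by ring
      omega
    · omega
  obtain ⟨k', rfl⟩ : ∃ k', k = k' + 2 := ⟨k - 2, by omega⟩
  have ek : (k' + 2) * e = k' * e + e + e := by ring
  have n1 : W[q]? ≠ W[q + e]? := by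
    intro h
    refine hf' e he q hlen ?_
    intro i h1 h2
    rcases Nat.eq_or_lt_of_le h1 with h3 | h3
    · subst h3; exact h
    · exact hpW i h3 h2
  have n2 : W[q + k' * e + e]? ≠ W[q + k' * e + e + e]? := by
    intro h
    refine hf' e he (q + 1) (by omega) ?_
    intro i h1 h2
    by_cases h3 : i + e < q + (k' + 2) * e
    · exact hpW i h1 h3
    · have : i = q + k' * e + e := by omega
      subst this; exact h
  have n3 : W[q + k' * e + e]? = W[q + e]? := by
    have := per_mod _ e _ _ (by omega) hpW (k' * e + (e - 1)) (by omega)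
    rw [Nat.add_comm (k' * e), Nat.add_mul_mod_self_right, Nat.mod_eq_of_lt (by omega)] at this
    rw [show q + 1 + (e - 1 + k' * e) = q + k' * e + e by omega, show q + 1 + (e - 1) = q + e by omega] at this
    exact this
  obtain ⟨a0, h0⟩ : ∃ a0, W[q]? = some a0 := ⟨_, List.getElem?_eq_getElem (by omega)⟩
  obtain ⟨a, ha⟩ : ∃ a, W[q + e]? = some a := ⟨_, List.getElem?_eq_getElem (by omega)⟩
  obtain ⟨ak, hak⟩ : ∃ ak, W[q + k' * e + e + e]? = some ak := ⟨_, List.getElem?_eq_getElem (by omega)⟩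
  rw [n3, ha, hak] at n2
  rw [h0, ha] at n1
  rw [ha] at n3
  have hne1 : a0 ≠ a := fun h => n1 (by rw [h])
  have hne2 : a ≠ ak := fun h => n2 (by rw [h])
  set V := a0 :: (List.replicate (k' + 1) a ++ [ak]) with hV
  have hVl : V.length = k' + 3 := by simp [hV]
  have hV0 : V[0]? = some a0 := by simp [hV]
  have hV1 : ∀ i, 1 ≤ i → i ≤ k' + 1 → V[i]? = some a := by
    intro i h1 h2
    obtain ⟨j, rfl⟩ : ∃ j, i = j + 1 := ⟨i - 1, by omega⟩
    rw [hV, List.getElem?_cons_succ, List.getElem?_append_left (by simp; omega)]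
    simp [List.getElem?_replicate]; omega
  have hV2 : V[k' + 2]? = some ak := by
    rw [hV, List.getElem?_cons_succ, List.getElem?_append_right (by simp)]
    simp
  refine C.noPer V (by omega) ?_ L hL r ?_ ?_
  · rw [kpf_iff _ (by omega)]
    intro p hp s hs hper
    rw [hVl] at hs
    have hp1 : p = 1 := by
      by_contra hne
      have : (k' + 2) * 2 ≤ (k' + 2) * p := Nat.mul_le_mul_left _ (by omega)
      omega
    subst hp1
    by_cases hs0 : s = 0
    · have := hper 0 (by omega) (by omega)
      simp only at this
      rw [hV0, hV1 _ (by omega) (by omega)] at this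
      exact hne1 (by simpa using this)
    · have := hper (k' + 1) (by omega) (by omega)
      simp only at this
      rw [hV2, hV1 _ (by omega) (by omega)] at this
      exact hne2 (by simpa using this)
  · rw [hVl]
    have e1 : (k' + 3) * L = (k' + 2) * L + L := by ring
    omega
  · intro x hx1 hx2
    obtain ⟨i, y, hy, rfl⟩ : ∃ q r, r < L ∧ x = q * L + r :=
      ⟨x / L, x % L, Nat.mod_lt _ hL, by rw [Nat.mul_comm]; exact (Nat.div_add_mod x L).symm⟩
    have hi : i ≤ k' + 1 := by
      by_contra hc
      have : (k' + 2) * L ≤ i * L := Nat.mul_le_mul_right _ (by omega)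
      omega
    rw [show i * L + y + L = (i + 1) * L + y by ring, T_blk C _ _ _ hy, T_blk C _ _ _ hy]
    have ekL : (k' + 2) * (e * L) = k' * (e * L) + e * L + e * L := by ring
    have p1 : e * L ≥ L := Nat.le_mul_of_pos_left _ (by omega)
    by_cases hi0 : i = 0
    · subst hi0
      have := hper (q * L + y) (by omega) (by omega)
      rw [show q * L + y + e * L = (q + e) * L + y by ring, T_blk C _ _ _ hy, T_blk C _ _ _ hy, h0, ha] at this
      rw [hV0, hV1 _ (by omega) (by omega)]; exact this
    by_cases hik : i = k' + 1
    · subst hik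
      have e5 : (k' + 2) * L = (k' + 1) * L + L := by ring
      have := hper ((q + k' * e + e) * L + y) (by 
        have : (q + k' * e + e) * L = q * L + k' * (e * L) + e * L := by ring
        have := Nat.zero_le (k' * (e * L))
        omega) (by
        have : (q + k' * e + e) * L = q * L + k' * (e * L) + e * L := by ring
        omega)
      rw [show (q + k' * e + e) * L + y + e * L = (q + k' * e + e + e) * L + y by ring, T_blk C _ _ _ hy, T_blk C _ _ _ hy, n3, hak] at this
      rw [hV2, hV1 _ (by omega) (by omega)]; exact this
    · rw [hV1 _ (by omega) (by omega), hV1 _ (by omega) (by omega)]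

end TB

namespace TB

lemma kpf_infix {γ : Type*} {k : ℕ} {V W : List γ} (h : V <:+: W) (hW : kPowerFree k W) : kPowerFree k V :=
  fun u hu hin => hW u hu (hin.trans h)

lemma sub_infix {γ : Type*} (W : List γ) (i N : ℕ) : (W.drop i).take N <:+: W :=
  (List.take_prefix _ _).isInfix.trans (List.drop_suffix _ _).isInfix

lemma sub_len {γ : Type*} (W : List γ) (i N : ℕ) (h : i + N ≤ W.length) : ((W.drop i).take N).length = N := by
  simp; omega

lemma sub_get {γ : Type*} (W : List γ) (i N x : ℕ) (hx : x < N) : ((W.drop i).take N)[x]? = W[i + x]? := by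
  rw [List.getElem?_take_of_lt hx, List.getElem?_drop]

lemma T_sub {α β : Type*} {k L B : ℕ} {g : α → List β} (C : Ctx k g L B) (W : List α) (i N x : ℕ) (hx : x < N * L) :
    T g ((W.drop i).take N) x = T g W (i * L + x) := by
  rw [T, f_take g L C.hu, f_drop g L C.hu, List.getElem?_take_of_lt hx, List.getElem?_drop]; rfl

lemma T_per {α β : Type*} {k L B : ℕ} {g : α → List β} (C : Ctx k g L B) (W : List α) (m i j : ℕ)
    (h : Per (fun x => W[x]?) m i j) : Per (T g W) (m * L) (i * L) (j * L) := by
  have hL := C.hL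
  intro x h1 h2
  obtain ⟨q, y, hy, rfl⟩ : ∃ q r, r < L ∧ x = q * L + r :=
    ⟨x / L, x % L, Nat.mod_lt _ hL, by rw [Nat.mul_comm]; exact (Nat.div_add_mod x L).symm⟩
  rw [show q * L + y + m * L = (q + m) * L + y by ring] at h2 ⊢
  rw [T_blk C _ _ _ hy, T_blk C _ _ _ hy]
  have a1 : i ≤ q := by
    by_contra hc
    have : (q + 1) * L ≤ i * L := Nat.mul_le_mul_right _ (by omega)
    rw [Nat.add_mul] at this; omega
  have a2 : q + m < j := by
    by_contra hc
    have : j * L ≤ (q + m) * L := Nat.mul_le_mul_right _ (by omega)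
    omega
  have := h q a1 a2
  simp only at this
  rw [this]

/-- trimming an occurrence -/
lemma trim {α β : Type*} {k L B : ℕ} {g : α → List β} (C : Ctx k g L B) (W : List α) (u : List β)
    (h : wpow u k <:+: applyMorph g W) : ∃ (V : List α) (s : ℕ), V <:+: W ∧ s < L ∧
      s + k * u.length ≤ V.length * L ∧ V.length * L < s + k * u.length + L ∧
      ∀ x < k * u.length, T g V (s + x) = u[x % u.length]? := by
  have hL := C.hL
  rw [infix_iff] at h
  obtain ⟨s', hs, hx⟩ := h
  rw [wpow_length, len_f g L C.hu] at hs
  rw [wpow_length] at hx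
  set ℓ := k * u.length with hℓ
  obtain ⟨q, s, hsL, rfl⟩ : ∃ q r, r < L ∧ s' = q * L + r :=
    ⟨s' / L, s' % L, Nat.mod_lt _ hL, by rw [Nat.mul_comm]; exact (Nat.div_add_mod s' L).symm⟩
  obtain ⟨N, hN1, hN2⟩ : ∃ N, s + ℓ ≤ N * L ∧ N * L < s + ℓ + L := by
    refine ⟨(s + ℓ + (L - 1)) / L, ?_, ?_⟩
    · have := Nat.div_add_mod (s + ℓ + (L - 1)) L
      have := Nat.mod_lt (s + ℓ + (L - 1)) hL
      rw [Nat.mul_comm]; omega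
    · have := Nat.div_mul_le_self (s + ℓ + (L - 1)) L
      omega
  have hqN : q + N ≤ W.length := by
    by_contra hc
    have : (W.length + 1) * L ≤ (q + N) * L := Nat.mul_le_mul_right _ (by omega)
    rw [Nat.add_mul, Nat.add_mul] at this
    omega
  refine ⟨(W.drop q).take N, s, sub_infix _ _ _, hsL, ?_, ?_, ?_⟩
  · rw [sub_len _ _ _ hqN]; exact hN1
  · rw [sub_len _ _ _ hqN]; exact hN2
  · intro x hxx
    rw [T_sub C _ _ _ _ (by omega), ← wpow_get u k x hxx, ← hx x hxx, T, Nat.add_assoc]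

lemma exists_rep (M x a : ℕ) (hM : 0 < M) : ∃ x', a ≤ x' ∧ x' < a + M ∧ x' % M = x % M := by
  induction a with
  | zero => exact ⟨x % M, by omega, by have := Nat.mod_lt x hM; omega, Nat.mod_mod _ _⟩
  | succ a ih =>
    obtain ⟨x', h1, h2, h3⟩ := ih
    by_cases h : x' = a
    · exact ⟨x' + M, by omega, by omega, by rw [Nat.add_mod_right, h3]⟩
    · exact ⟨x', by omega, by omega, h3⟩

lemma per_congr {γ : Type*} {F : ℕ → γ} {q a b : ℕ} (h : Per F q a b) (x y : ℕ) (hx : a ≤ x) (hx' : x < b)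
    (hy : a ≤ y) (hy' : y < b) (hxy : x % q = y % q) : F x = F y := by
  have key : ∀ n x, a ≤ x → x + n * q < b → F x = F (x + n * q) := by
    intro n
    induction n with
    | zero => intro x _ _; simp
    | succ n ih =>
      intro x h1 h2
      have e : (n + 1) * q = n * q + q := by ring
      rw [e] at h2 ⊢
      rw [ih x h1 (by omega), h (x + n * q) (by omega) (by omega)]; congr 1; omega
  have key2 : ∀ x y, x ≤ y → a ≤ x → y < b → x % q = y % q → F x = F y := by
    intro x y hxy' h1 h2 h3
    obtain ⟨n, hn⟩ := (Nat.modEq_iff_dvd' hxy').1 h3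
    have : y = x + n * q := by rw [Nat.mul_comm] at hn; omega
    rw [this]; exact key n x h1 (by omega)
  rcases le_total x y with h' | h'
  · exact key2 x y h' hx hy' hxy
  · exact (key2 y x h' hy hx' hxy.symm).symm

lemma fwbad {α β : Type*} {k L B : ℕ} {g : α → List β} (C : Ctx k g L B) (W : List α) (s p : ℕ)
    (hLp : ¬ L ∣ p) (hpL : L < p) (hsL : s < L) (h1 : s + k * p ≤ W.length * L)
    (h2 : W.length * L < s + k * p + L) (hper : Per (T g W) p s (s + k * p)) (i m : ℕ) (hm : 1 ≤ m)
    (him : i + k * m ≤ W.length) (hW : Per (fun x => W[x]?) m i (i + k * m))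
    (hmin : ∀ m' i', 1 ≤ m' → m' < m → i' + k * m' ≤ W.length → ¬ Per (fun x => W[x]?) m' i' (i' + k * m'))
    (hmB : (k - 1) * m ≤ B) :
    ∃ a b, s ≤ a ∧ b ≤ s + k * p ∧ a ≤ b ∧ Per (T g W) (m * L) a b ∧ b < a + p + m * L ∧
      (b = a + k * (m * L) ∨ (a = s ∧ s + k * (m * L) + 1 ≤ b + L) ∨
        (b = s + k * p ∧ a + k * (m * L) + 1 ≤ b + L)) := by
  have hk := C.hk
  have hL := C.hL
  have hM : 0 < m * L := Nat.mul_pos hm hL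
  have hJ : Per (T g W) (m * L) (i * L) (i * L + k * (m * L)) := by
    have := T_per C W _ _ _ hW
    rwa [show (i + k * m) * L = i * L + k * (m * L) by ring] at this
  have himL : i * L + k * (m * L) ≤ W.length * L := by
    have := Nat.mul_le_mul_right L him
    rwa [show (i + k * m) * L = i * L + k * (m * L) by ring] at this
  have hkM : m * L ≤ k * (m * L) := Nat.le_mul_of_pos_left _ (by omega)
  have hkp : p ≤ k * p := Nat.le_mul_of_pos_left _ (by omega)
  -- main argument
  have key : ∀ a b, s ≤ a → i * L ≤ a → b ≤ s + k * p → b ≤ i * L + k * (m * L) → a + p + m * L ≤ b → False := by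
    intro a b ha1 ha2 hb1 hb2 hab
    have q1 : Per (T g W) p a b := fun x hx hx' => hper x (by omega) (by omega)
    have q2 : Per (T g W) (m * L) a b := fun x hx hx' => hJ x (by omega) (by omega)
    have q3 := fw (T g W) a b _ p (m * L) le_rfl hab q1 q2
    set γ := Nat.gcd p (m * L) with hγ
    have hγ0 : 0 < γ := Nat.gcd_pos_of_pos_right _ hM
    have hγp : γ ≤ p := Nat.gcd_le_left _ (by omega)
    have hγM : γ ∣ m * L := Nat.gcd_dvd_right _ _
    have hγne : γ ≠ m * L := by
      intro h
      apply hLp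
      have : γ ∣ p := Nat.gcd_dvd_left _ _
      rw [h] at this
      exact (Dvd.intro_left m rfl).trans this
    have hγ2 : 2 * γ ≤ m * L := by
      obtain ⟨c, hc⟩ := hγM
      rw [hc] at hM hγne ⊢
      have hc2 : 2 ≤ c := by
        by_contra hcc
        have : c = 0 ∨ c = 1 := by omega
        rcases this with rfl | rfl
        · simp at hM
        · simp at hγne
      calc 2 * γ ≤ c * γ := Nat.mul_le_mul_right _ hc2
        _ = γ * c := Nat.mul_comm _ _
    have q4 : Per (T g W) γ (i * L) (i * L + k * (m * L)) := by
      intro x hx1 hx2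
      obtain ⟨x', hx'1, hx'2, hx'3⟩ := exists_rep (m * L) x a hM
      rw [per_congr hJ x x' (by omega) (by omega) (by omega) (by omega) hx'3.symm,
        q3 x' (by omega) (by omega)]
      exact per_congr hJ _ _ (by omega) (by omega) (by omega) (by omega) (Nat.ModEq.add_right γ hx'3)
    obtain ⟨k', rfl⟩ : ∃ k', k = k' + 2 := ⟨k - 2, by omega⟩
    have ek : k' + 2 - 1 = k' + 1 := by omega
    rw [ek] at hmB
    have ekm : (k' + 2) * m = (k' + 1) * m + m := by ring
    refine C.noPer ((W.drop i).take ((k' + 1) * m)) (by rw [sub_len _ _ _ (by omega)]; exact hmB) ?_ γ hγ0 0 ?_ ?_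
    · rw [kpf_iff _ (by omega)]
      intro m' hm' j hj hperj
      rw [sub_len _ _ _ (by omega)] at hj
      have hlt : m' < m := by
        by_contra hc
        have : (k' + 2) * m ≤ (k' + 2) * m' := Nat.mul_le_mul_left _ (by omega)
        omega
      refine hmin m' (i + j) hm' hlt (by omega) ?_
      intro x hx1 hx2
      have := hperj (x - i) (by omega) (by omega)
      try simp only at this
      rw [sub_get _ _ _ _ (by omega), sub_get _ _ _ _ (by omega)] at this
      rw [show i + (x - i) = x by omega, show i + (x - i + m') = x + m' by omega] at this
      exact this
    · rw [sub_len _ _ _ (by omega)]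
      have : (k' + 1) * m * L = (k' + 1) * (m * L) := by ring
      rw [this]
      nlinarith
    · have hbd : (k' + 2) * γ ≤ (k' + 1) * m * L := by
        have : (k' + 1) * m * L = (k' + 1) * (m * L) := by ring
        rw [this]
        nlinarith
      have hbd2 : (k' + 1) * m * L + m * L = (k' + 2) * (m * L) := by ring
      intro x _ hx2
      rw [T_sub C _ _ _ _ (by omega), T_sub C _ _ _ _ (by omega), q4 (i * L + x) (by omega) (by omega), Nat.add_assoc]
  by_cases hl : s ≤ i * L
  · by_cases hr : i * L + k * (m * L) ≤ s + k * p
    · refine ⟨i * L, i * L + k * (m * L), hl, hr, by omega, hJ, ?_, Or.inl rfl⟩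
      by_contra hc
      exact key _ _ hl le_rfl hr le_rfl (by omega)
    · by_cases hle : i * L ≤ s + k * p
      · refine ⟨i * L, s + k * p, hl, le_rfl, hle, fun x hx hx' => hJ x hx (by omega), ?_, 
          Or.inr (Or.inr ⟨rfl, by omega⟩)⟩
        by_contra hc
        exact key _ _ hl le_rfl le_rfl (by omega) (by omega)
      · exfalso
        have : L ≤ m * L := Nat.le_mul_of_pos_left _ hm
        omega
  · have hi0 : i = 0 := by
      by_contra hc
      have : L ≤ i * L := Nat.le_mul_of_pos_left _ (by omega)
      omega
    subst hi0
    by_cases hr : 0 * L + k * (m * L) ≤ s + k * p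
    · have hsb : s ≤ 0 * L + k * (m * L) := by
        have : L ≤ m * L := Nat.le_mul_of_pos_left _ hm
        omega
      refine ⟨s, 0 * L + k * (m * L), le_rfl, hr, hsb, fun x hx hx' => hJ x (by omega) (by omega), ?_, 
          Or.inr (Or.inl ⟨rfl, by omega⟩)⟩
      by_contra hc
      exact key _ _ le_rfl (by omega) hr le_rfl (by omega)
    · exfalso
      refine key s (s + k * p) le_rfl (by omega) le_rfl (by omega) ?_
      by_contra hc
      have c1 : k * p < p + m * L := by omega
      have c2 : k * (m * L) < k * p + 2 * p := by omega
      obtain ⟨k', rfl⟩ : ∃ k', k = k' + 3 := ⟨k - 3, by omega⟩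
      have c3 : (k' + 2) * p + 1 ≤ m * L := by
        have : (k' + 3) * p = (k' + 2) * p + p := by ring
        omega
      have c4 := Nat.mul_le_mul_left (k' + 3) c3
      nlinarith [Nat.zero_le (k' * k' * p), Nat.zero_le (k' * p)]

end TB

namespace TB

def Fact {α β : Type*} (g : α → List β) (z : List β) : Prop := ∃ W, z <:+: applyMorph g W

/-- the infinite periodic word -/
def tt {β : Type*} (u : List β) (i : ℕ) : Option β := u[i % u.length]?

lemma Fact.mono {α β : Type*} {g : α → List β} {z z' : List β} (h : Fact g z) (hz : z' <:+: z) : Fact g z' := by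
  obtain ⟨W, hW⟩ := h
  exact ⟨W, hz.trans hW⟩

lemma D1 {α β : Type*} {k L B : ℕ} {g : α → List β} (C : Ctx k g L B) (X A y Z : List β) (d : ℕ)
    (hA : A.length = L) (hd : A.length + y.length = d * L)
    (h : Fact g (X ++ A ++ y ++ A ++ Z)) : Fact g (X ++ A ++ Z) := by
  have hL := C.hL
  obtain ⟨W, P, S, hW⟩ := h
  obtain ⟨b, hN1, hN2⟩ : ∃ N, P.length + X.length ≤ N * L ∧ N * L < P.length + X.length + L := by
    refine ⟨(P.length + X.length + (L - 1)) / L, ?_, ?_⟩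
    · have := Nat.div_add_mod (P.length + X.length + (L - 1)) L
      have := Nat.mod_lt (P.length + X.length + (L - 1)) hL
      rw [Nat.mul_comm]; omega
    · have := Nat.div_mul_le_self (P.length + X.length + (L - 1)) L
      omega
  obtain ⟨A1, A2, rfl, hA1⟩ : ∃ A1 A2, A = A1 ++ A2 ∧ A1.length = b * L - (P.length + X.length) :=
    ⟨A.take (b * L - (P.length + X.length)), A.drop (b * L - (P.length + X.length)),
      (List.take_append_drop _ _).symm, by simp; omega⟩
  have e : applyMorph g W = (P ++ X ++ A1) ++ ((A2 ++ y ++ A1) ++ (A2 ++ Z ++ S)) := by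
    rw [← hW]; simp [List.append_assoc]
  refine ⟨W.take b ++ W.drop (b + d), P, S, ?_⟩
  rw [f_append, f_take g L C.hu, f_drop g L C.hu, e, List.take_left' (by simp; omega),
    ← List.append_assoc (P ++ X ++ A1) (A2 ++ y ++ A1) (A2 ++ Z ++ S),
    List.drop_left']
  · simp [List.append_assoc]
  · simp only [List.length_append] at *
    rw [Nat.add_mul]; omega

lemma D2 {α β : Type*} {k L B : ℕ} {g : α → List β} (C : Ctx k g L B) (X x A y z Z : List β) (d n : ℕ)
    (hA : A.length = L) (hd : A.length + y.length = d * L)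
    (h : Fact g (X ++ wpow (x ++ A ++ y ++ A ++ z) n ++ Z)) : Fact g (X ++ wpow (x ++ A ++ z) n ++ Z) := by
  induction n generalizing X with
  | zero => simpa [wpow_zero'] using h
  | succ n ih =>
    rw [wpow_succ'] at h ⊢
    have h1 : Fact g ((X ++ x) ++ A ++ y ++ A ++ (z ++ wpow (x ++ A ++ y ++ A ++ z) n ++ Z)) := by
      simpa only [List.append_assoc] using h
    have h2 := D1 C _ _ _ _ d hA hd h1
    have h3 := ih (X ++ x ++ A ++ z) (by simpa only [List.append_assoc] using h2)
    simpa only [List.append_assoc] using h3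

lemma wpow_comm {β : Type*} (a b : List β) (n : ℕ) : wpow (a ++ b) (n + 1) = a ++ wpow (b ++ a) n ++ b := by
  induction n with
  | zero => simp [wpow_succ', wpow_zero']
  | succ n ih =>
    rw [wpow_succ', ih, wpow_succ']; simp only [List.append_assoc]

lemma tt_rot {β : Type*} (a b : List β) (i : ℕ) : tt (a ++ b) i = tt (b ++ a) (i + b.length) := by
  by_cases h0 : (b ++ a).length = 0
  · have : a = [] ∧ b = [] := by simpa [and_comm] using h0
    rw [this.1, this.2]; simp
  have hl : (a ++ b).length = (b ++ a).length := by simp [Nat.add_comm]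
  have : (b ++ a).rotate b.length = a ++ b := by rw [List.rotate_append_length_eq]
  rw [tt, tt, ← this, List.length_rotate, List.getElem?_rotate (Nat.mod_lt _ (by omega)), Nat.mod_add_mod]

lemma cyc {α β : Type*} {k L B : ℕ} {g : α → List β} (C : Ctx k g L B) (a b A y z : List β) (d : ℕ)
    (hA : A.length = L) (hd : A.length + y.length = d * L)
    (hba : b ++ a = A ++ y ++ A ++ z) (h : Fact g (wpow (a ++ b) k)) :
    ∃ u' e, u'.length = (A ++ z).length ∧ Fact g (wpow u' k) ∧ ∀ i, tt u' i = tt (A ++ z) (i + e) := by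
  obtain ⟨K, rfl⟩ : ∃ K, k = K + 1 := ⟨k - 1, by have := C.hk; omega⟩
  rw [wpow_comm, hba] at h
  have h1 : Fact g (a ++ wpow (A ++ z) K ++ b) := by
    have := D2 C a [] A y z b d K hA hd (by simpa using h)
    simpa using this
  rw [List.append_assoc (A ++ y) A z, List.append_eq_append_iff] at hba
  rcases hba with ⟨a', h2, h3⟩ | ⟨b', h2, h3⟩
  · refine ⟨A ++ z, 0, rfl, ?_, fun i => rfl⟩
    rw [h3] at h1
    refine h1.mono ?_
    rw [wpow_succ']
    exact ⟨a', b, by simp only [List.append_assoc]⟩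
  · refine ⟨a ++ b', b'.length, ?_, ?_, ?_⟩
    · rw [h3]; simp [Nat.add_comm]
    · rw [wpow_comm, ← h3]
      rw [h2] at h1
      rw [List.append_eq_append_iff] at h3
      rcases h3 with ⟨c, h4, h5⟩ | ⟨c, h4, h5⟩
      · rw [h4]
        have h6 := D1 C (a ++ wpow (A ++ z) K) A y c d hA hd (by rw [h4] at h1; simpa only [List.append_assoc] using h1)
        simpa only [List.append_assoc] using h6
      · refine h1.mono ⟨[], c ++ y ++ b', ?_⟩
        conv_rhs => rw [h4]
        rw [← h4]
        simp [h4]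
    · rw [h3]; intro i; exact tt_rot a b' i

lemma tt_mod {β : Type*} (u : List β) (i j : ℕ) (h : i % u.length = j % u.length) : tt u i = tt u j := by
  rw [tt, tt, h]

lemma cyc_idx {α β : Type*} {k L B : ℕ} {g : α → List β} (C : Ctx k g L B) (u : List β) (y d : ℕ)
    (hd : 1 ≤ d) (hdp : (d + 1) * L ≤ u.length) (hw : ∀ x < L, tt u (y + x) = tt u (y + x + d * L))
    (h : Fact g (wpow u k)) :
    ∃ u' v e, u'.length = v.length ∧ v.length + d * L = u.length ∧ Fact g (wpow u' k) ∧
      (∀ i, tt u' i = tt v (i + e)) ∧ ∀ i < v.length, tt v i = tt u (y + i + d * L) := by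
  have hL := C.hL
  have hdL : L ≤ d * L := Nat.le_mul_of_pos_left _ hd
  have hdp' : d * L + L ≤ u.length := by rw [Nat.add_mul] at hdp; omega
  set p := u.length with hp
  have hy0 : y % p < p := Nat.mod_lt _ (by omega)
  set a := u.take (y % p) with ha
  set b := u.drop (y % p) with hb
  have hal : a.length = y % p := by simp [ha]; omega
  have hub : a ++ b = u := List.take_append_drop _ _
  set V := b ++ a with hV
  have hVl : V.length = p := by rw [hp, ← hub, hV]; simp [Nat.add_comm]
  have hVi : ∀ i < p, V[i]? = tt u (y + i) := by
    intro i hi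
    have := tt_rot b a i
    rw [hub, ← hV, tt, hVl, Nat.mod_eq_of_lt hi, hal] at this
    rw [this]
    apply tt_mod
    rw [← hp, Nat.add_mod_mod, Nat.add_comm]
  set v := V.drop (d * L) with hv
  have hvl : v.length + d * L = p := by rw [hv, List.length_drop, hVl]; omega
  set A := v.take L with hA
  have hAl : A.length = L := by rw [hA, List.length_take]; omega
  have hAz : A ++ v.drop L = v := List.take_append_drop _ _
  set Y := (V.drop L).take (d * L - L) with hY
  have hYl : Y.length = d * L - L := by rw [hY]; simp; omega
  have e1 : V.take L = A := by
    apply List.ext_getElem?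
    intro i
    by_cases hi : i < L
    · rw [hA, List.getElem?_take_of_lt hi, List.getElem?_take_of_lt hi, hv, List.getElem?_drop, hVi _ (by omega),
        hVi _ (by omega), hw i hi]
      congr 1; omega
    · rw [List.getElem?_eq_none (by simp; omega), List.getElem?_eq_none (by omega)]
  have e2 : V = A ++ Y ++ A ++ v.drop L := by
    rw [List.append_assoc, hAz]
    have : V = V.take L ++ (V.drop L).take (d * L - L) ++ (V.drop L).drop (d * L - L) := by
      rw [List.append_assoc, List.take_append_drop, List.take_append_drop]
    rw [e1, List.drop_drop, show L + (d * L - L) = d * L by omega] at this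
    exact this
  obtain ⟨u', e, h1, h2, h3⟩ := cyc C a b A Y (v.drop L) d hAl (by omega) e2 (by rw [hub]; exact h)
  rw [hAz] at h1 h3
  refine ⟨u', v, e, h1, hvl, h2, h3, ?_⟩
  intro i hi
  rw [tt, Nat.mod_eq_of_lt hi, hv, List.getElem?_drop, hVi _ (by omega)]
  congr 1; omega

end TB

namespace TB

lemma ins_ext {γ : Type*} (τ t : ℕ → γ) (p p' L d : ℕ) (hp : p = p' + d * L) (hLp : L ≤ p')
    (hτ : ∀ x, τ (x + p) = τ x) (hw : ∀ x < L, τ x = τ (x + d * L))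
    (ht : ∀ x, t (x + p') = t x) (hti : ∀ i < p', t i = τ (i + d * L)) :
    ∀ i < p' + L, t i = τ (i + d * L) := by
  intro i hi
  by_cases h : i < p'
  · exact hti i h
  · obtain ⟨j, rfl⟩ : ∃ j, i = j + p' := ⟨i - p', by omega⟩
    rw [ht, hti j (by omega), ← hw j (by omega), ← hτ]
    congr 1; omega

lemma ins {γ : Type*} (τ t : ℕ → γ) (p p' L : ℕ) (hp : p = p' + L) (hLp : L ≤ p')
    (hτ : ∀ x, τ (x + p) = τ x) (hw : ∀ x < L, τ x = τ (x + L))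
    (ht : ∀ x, t (x + p') = t x) (hti : ∀ i < p', t i = τ (i + L)) (y l : ℕ) (hy : y ≤ p')
    (h1 : p' + L ≤ y + l) (h2 : y + l ≤ 2 * p' + L)
    (hr : ∀ x, y ≤ x → x + L < y + l → t x = t (x + L)) :
    ∀ x, y + L ≤ x → x < y + L + l → τ x = τ (x + L) := by
  have ext := ins_ext τ t p p' L 1 (by omega) hLp hτ (by simpa using hw) ht (by simpa using hti)
  simp only [Nat.one_mul] at ext
  have ext2 : ∀ i, p' ≤ i → i < 2 * p' + L → t i = τ (i + 2 * L) := by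
    intro i hi1 hi2
    obtain ⟨j, rfl⟩ : ∃ j, i = j + p' := ⟨i - p', by omega⟩
    rw [ht, ext j (by omega), ← hτ]
    congr 1; omega
  intro x hx1 hx2
  obtain ⟨z, rfl⟩ : ∃ z, x = z + L := ⟨x - L, by omega⟩
  by_cases c1 : z < p'
  · rw [← ext z (by omega), ← ext (z + L) (by omega)]
    exact hr z (by omega) (by omega)
  by_cases c2 : z < p' + L
  · obtain ⟨j, rfl⟩ : ∃ j, z = j + p' := ⟨z - p', by omega⟩
    rw [show j + p' + L = j + p by omega, hτ, show j + p + L = j + L + p by omega, hτ]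
    exact hw j (by omega)
  · have := hr (z - L) (by omega) (by omega)
    rw [show z - L + L = z by omega, ext2 (z - L) (by omega) (by omega), ext2 z (by omega) (by omega)] at this
    rw [show z + L = z - L + 2 * L by omega, this]
    congr 1; omega

lemma kpres {γ : Type*} (τ t : ℕ → γ) (p p' L d : ℕ) (hp : p = p' + d * L) (hLp : 2 * L < p')
    (hτ : ∀ x, τ (x + p) = τ x) (hw : ∀ x < L, τ x = τ (x + d * L))
    (ht : ∀ x, t (x + p') = t x) (hti : ∀ i < p', t i = τ (i + d * L)) (y : ℕ)
    (hy : y < p') (hr : ∀ x < 2 * L, t (y + x) = t (y + x + L)) :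
    (∃ y, ∀ x < L, τ (y + x) = τ (y + x + L)) ∧ (d = 1 → ∃ y, ∀ x < 2 * L, τ (y + x) = τ (y + x + L)) := by
  have ext := ins_ext τ t p p' L d hp (by omega) hτ hw ht hti
  constructor
  · by_cases h : y + L ≤ p'
    · refine ⟨y + d * L, fun x hx => ?_⟩
      have := hr x (by omega)
      rw [ext _ (by omega), ext _ (by omega)] at this
      rw [show y + d * L + x = y + x + d * L by omega, this]
      congr 1; omega
    · refine ⟨d * L, fun x hx => ?_⟩
      have := hr (x + p' - y) (by omega)
      rw [show y + (x + p' - y) = x + p' by omega, show x + p' + L = x + L + p' by omega, ht, ht,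
        ext _ (by omega), ext _ (by omega)] at this
      rw [Nat.add_comm (d * L), this]
      congr 1; omega
  · rintro rfl
    simp only [Nat.one_mul] at *
    by_cases h : y + 2 * L ≤ p'
    · refine ⟨y + L, fun x hx => ?_⟩
      have := hr x (by omega)
      rw [ext _ (by omega), ext _ (by omega)] at this
      rw [show y + L + x = y + x + L by omega, this]
    · have := ins τ t p p' L hp (by omega) hτ hw ht hti y (3 * L) (by omega) (by omega) (by omega) (by
        intro x hx1 hx2
        have := hr (x - y) (by omega)
        rwa [show y + (x - y) = x by omega] at this)
      exact ⟨y + L, fun x hx => this _ (by omega) (by omega)⟩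

lemma min_pow {γ : Type*} (k : ℕ) (hk : 1 ≤ k) (W : List γ) (m0 : ℕ)
    (h : ∃ i, 1 ≤ m0 ∧ i + k * m0 ≤ W.length ∧ Per (fun x => W[x]?) m0 i (i + k * m0)) :
    ∃ m i, m ≤ m0 ∧ 1 ≤ m ∧ i + k * m ≤ W.length ∧ Per (fun x => W[x]?) m i (i + k * m) ∧
      ∀ m' i', 1 ≤ m' → m' < m → i' + k * m' ≤ W.length → ¬ Per (fun x => W[x]?) m' i' (i' + k * m') := by
  classical
  let P : ℕ → Prop := fun m => ∃ i, 1 ≤ m ∧ i + k * m ≤ W.length ∧ Per (fun x => W[x]?) m i (i + k * m)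
  have hP : ∃ m, P m := ⟨m0, h⟩
  obtain ⟨i, h1, h2, h3⟩ := Nat.find_spec hP
  refine ⟨Nat.find hP, i, Nat.find_min' hP h, h1, h2, h3, ?_⟩
  intro m' i' hm hlt hl hper
  exact Nat.find_min hP hlt ⟨i', hm, hl, hper⟩

lemma not_kpf {γ : Type*} (k : ℕ) (hk : 1 ≤ k) (W : List γ) (h : ¬ kPowerFree k W) :
    ∃ m i, 1 ≤ m ∧ i + k * m ≤ W.length ∧ Per (fun x => W[x]?) m i (i + k * m) := by
  rw [kpf_iff k hk] at h
  push Not at h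
  obtain ⟨p, hp, a, ha, hper⟩ := h
  exact ⟨p, a, hp, ha, hper⟩

lemma km_small {k m L : ℕ} (hk : 3 ≤ k) (hm : 1 ≤ m) (h : k * (m * L) < m * L + 3 * L) : k = 3 ∧ m = 1 := by
  obtain ⟨k', rfl⟩ : ∃ k', k = k' + 3 := ⟨k - 3, by omega⟩
  have h' : ((k' + 2) * m) * L < 3 * L := by nlinarith
  have h2 := Nat.lt_of_mul_lt_mul_right h'
  have : m = 1 := by nlinarith
  subst this
  omega

/-- an occurrence in index form -/
lemma per_of_T {α β : Type*} {g : α → List β} {k : ℕ} (V : List α) (u : List β) (s : ℕ)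
    (h : ∀ x < k * u.length, T g V (s + x) = u[x % u.length]?) : Per (T g V) u.length s (s + k * u.length) := by
  intro x h1 h2
  have e1 := h (x - s) (by omega)
  have e2 := h (x - s + u.length) (by omega)
  rw [Nat.add_mod_right, ← e1] at e2
  rw [show s + (x - s) = x by omega, show s + (x - s + u.length) = x + u.length by omega] at e2
  exact e2.symm

lemma level2 {α β : Type*} {k L B : ℕ} {g : α → List β} (C : Ctx k g L B) (u : List β)
    (h : Fact g (wpow u k)) (h1 : L < u.length) (h2 : u.length < 2 * L) :
    k = 3 ∧ ((∀ x < L, tt u x = tt u (x + L)) ∨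
      ∀ x < L, tt u (3 * u.length - 2 * L + x) = tt u (3 * u.length - L + x)) := by
  obtain ⟨W, hW⟩ := h
  have hk := C.hk
  have hL := C.hL
  have hB := C.hB
  obtain ⟨V, s, -, hs, hl1, hl2, hT⟩ := trim C W u hW
  have hper := per_of_T V u s hT
  set p := u.length with hp
  have hVl : V.length ≤ 2 * k + 1 := by
    have : k * p ≤ k * (2 * L) := Nat.mul_le_mul_left _ h2.le
    have h3 : V.length * L < (2 * k + 2) * L := by
      have : (2 * k + 2) * L = k * (2 * L) + 2 * L := by ring
      omega
    have := Nat.lt_of_mul_lt_mul_right h3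
    omega
  have hLp : ¬ L ∣ p := by
    rintro ⟨c, hc⟩
    rw [hc] at h1 h2
    have : 1 < c := by nlinarith
    nlinarith
  have hbad : ¬ kPowerFree k V := fun hf => C.noPer V (by omega) hf p (by omega) s hl1 hper
  obtain ⟨m0, i0, hm0⟩ := not_kpf k (by omega) V hbad
  obtain ⟨m, i, -, hm, him, hWp, hmin⟩ := min_pow k (by omega) V m0 ⟨i0, hm0⟩
  have hkm : (k - 1) * m ≤ k * m := Nat.mul_le_mul_right _ (by omega)
  obtain ⟨a, b, ha, hb, hab, hO, hlen, hc⟩ := fwbad C V s p hLp h1 hs hl1 hl2 hper i m hm him hWp hmin (by omega)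
  rcases hc with hc | ⟨hc1, hc2⟩ | ⟨hc1, hc2⟩
  · exfalso
    obtain ⟨rfl, rfl⟩ := km_small hk hm (show k * (m * L) < m * L + 3 * L by omega)
    omega
  · obtain ⟨rfl, rfl⟩ := km_small hk hm (show k * (m * L) < m * L + 3 * L by omega)
    refine ⟨rfl, Or.inl ?_⟩
    intro x hx
    have := hO (s + x) (by omega) (by omega)
    rw [Nat.one_mul, Nat.add_assoc, hT _ (by omega), hT _ (by omega)] at this
    exact this
  · obtain ⟨rfl, rfl⟩ := km_small hk hm (show k * (m * L) < m * L + 3 * L by omega)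
    refine ⟨rfl, Or.inr ?_⟩
    intro x hx
    have := hO (s + (3 * p - 2 * L + x)) (by omega) (by omega)
    rw [Nat.one_mul, Nat.add_assoc, hT _ (by omega), hT _ (by omega)] at this
    rw [show 3 * p - L + x = 3 * p - 2 * L + x + L by omega]
    exact this

/-- the class of remaining bad periods -/
structure Cls {α β : Type*} (g : α → List β) (k L : ℕ) (u : List β) : Prop where
  nd : ¬ L ∣ u.length
  gt : 2 * L < u.length
  occ : Fact g (wpow u k)
  K : k = 3 → ¬ ∃ y, ∀ x < 2 * L, tt u (y + x) = tt u (y + x + L)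

lemma tt_add {β : Type*} (u : List β) (x : ℕ) : tt u (x + u.length) = tt u x := by
  simp [tt]

lemma tt_modadd {β : Type*} (u : List β) (y x : ℕ) : tt u (y % u.length + x) = tt u (y + x) := by
  simp [tt]

lemma star {α β : Type*} {k L B : ℕ} {g : α → List β} (C : Ctx k g L B) (u : List β) (hu : Cls g k L u)
    (hmin : ∀ u', Cls g k L u' → u.length ≤ u'.length) (d : ℕ) (hd : 1 ≤ d) (hdp : (d + 1) * L ≤ u.length)
    (y : ℕ) (hw : ∀ x < L, tt u (y + x) = tt u (y + x + d * L)) : u.length < (d + 2) * L := by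
  classical
  have hL := C.hL
  let P : ℕ → Prop := fun d => 1 ≤ d ∧ ∃ y, ∀ x < L, tt u (y + x) = tt u (y + x + d * L)
  have hP : ∃ d, P d := ⟨d, hd, y, hw⟩
  obtain ⟨h1, y0, hw0⟩ := Nat.find_spec hP
  have hle : Nat.find hP ≤ d := Nat.find_min' hP ⟨hd, y, hw⟩
  have hlt : ∀ d', d' < Nat.find hP → ¬ P d' := fun d' h => Nat.find_min hP h
  generalize Nat.find hP = d0 at h1 hw0 hle hlt
  have hdp0 : (d0 + 1) * L ≤ u.length := (Nat.mul_le_mul_right L (by omega)).trans hdp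
  obtain ⟨u', v, e, e1, e2, e3, e4, e5⟩ := cyc_idx C u y0 d0 h1 hdp0 hw0 hu.occ
  have hv : ¬ L ∣ v.length := by
    intro h
    apply hu.nd
    rw [← e2]
    exact Nat.dvd_add h (Dvd.intro_left _ rfl)
  have hdL : L ≤ d0 * L := Nat.le_mul_of_pos_left _ h1
  have hv2 : v.length < 2 * L := by
    by_contra hc
    have hne : v.length ≠ 2 * L := fun h => hv (by rw [h]; exact Dvd.intro_left _ rfl)
    have hcls : Cls g k L u' := by
      refine ⟨by rw [e1]; exact hv, by omega, e3, ?_⟩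
      rintro hk3 ⟨z, hz⟩
      have := kpres (fun x => tt u (y0 + x)) (tt v) u.length v.length L d0 e2.symm (by omega)
        (fun x => by rw [← Nat.add_assoc, tt_add]) (fun x hx => by rw [← Nat.add_assoc]; exact hw0 x hx)
        (fun x => tt_add v x) (fun i hi => by rw [← Nat.add_assoc]; exact e5 i hi) ((z + e) % v.length)
        (Nat.mod_lt _ (by omega)) (fun x hx => by
          rw [Nat.add_assoc, tt_modadd, tt_modadd]
          have := hz x hx
          rw [e4, e4] at this
          rw [show z + e + x = z + x + e by omega, this]
          congr 1; omega)
      obtain ⟨⟨z1, q1⟩, q2⟩ := this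
      by_cases hd1 : d0 = 1
      · obtain ⟨z2, q3⟩ := q2 hd1
        exact hu.K hk3 ⟨y0 + z2, fun x hx => by have := q3 x hx; simpa only [Nat.add_assoc] using this⟩
      · exact hlt 1 (by omega) ⟨le_rfl, y0 + z1, fun x hx => by
          have := q1 x hx; simpa only [Nat.add_assoc, Nat.one_mul] using this⟩
    have := hmin u' hcls
    omega
  calc u.length < (d0 + 2) * L := by rw [Nat.add_mul]; omega
    _ ≤ (d + 2) * L := Nat.mul_le_mul_right _ (by omega)

end TB

namespace TB

lemma take_drop_app {γ : Type*} (u : List γ) (a b : ℕ) : (u.drop a).take b ++ u.drop (a + b) = u.drop a := by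
  rw [← List.drop_drop, List.take_append_drop]

lemma del {α β : Type*} {k L B : ℕ} {g : α → List β} (C : Ctx k g L B) (u : List β) (y d : ℕ)
    (hd : 1 ≤ d) (hdp : y + (d * L + L) ≤ u.length) (hw : ∀ x < L, tt u (y + x) = tt u (y + x + d * L))
    (h : Fact g (wpow u k)) :
    ∃ v, v.length + d * L = u.length ∧ Fact g (wpow v k) ∧
      (∀ i < y, tt v i = tt u i) ∧ ∀ i, y ≤ i → i < v.length → tt v i = tt u (i + d * L) := by
  have hL := C.hL
  have hdL : L ≤ d * L := Nat.le_mul_of_pos_left _ hd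
  have htt : ∀ i < u.length, tt u i = u[i]? := fun i hi => by rw [tt, Nat.mod_eq_of_lt hi]
  set A := (u.drop y).take L with hA
  have hAl : A.length = L := by rw [hA]; simp; omega
  have hA2 : A = (u.drop (y + d * L)).take L := by
    apply List.ext_getElem?
    intro i
    by_cases hi : i < L
    · rw [hA, sub_get _ _ _ _ hi, sub_get _ _ _ _ hi, ← htt _ (by omega), ← htt _ (by omega), hw i hi]
      congr 1; omega
    · rw [List.getElem?_eq_none (by omega), List.getElem?_eq_none (by simp; omega)]
  set Y := (u.drop (y + L)).take (d * L - L) with hY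
  have hYl : Y.length = d * L - L := by rw [hY]; simp; omega
  have hAz : A ++ u.drop (y + d * L + L) = u.drop (y + d * L) := by
    rw [hA2, take_drop_app]
  have e2 : u = u.take y ++ A ++ Y ++ A ++ u.drop (y + d * L + L) := by
    rw [List.append_assoc _ A (List.drop _ _), hAz]
    have e3 : Y ++ u.drop (y + d * L) = u.drop (y + L) := by
      rw [hY, show y + d * L = (y + L) + (d * L - L) by omega, take_drop_app]
    have e4 : A ++ u.drop (y + L) = u.drop y := by
      rw [hA, take_drop_app]
    rw [List.append_assoc, List.append_assoc, e3, e4, List.take_append_drop]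
  have hF := D2 C [] (u.take y) A Y (u.drop (y + d * L + L)) [] d k hAl (by omega) (by rw [← e2]; simpa using h)
  rw [List.append_assoc _ A, hAz] at hF
  have hl : (u.take y ++ u.drop (y + d * L)).length + d * L = u.length := by simp; omega
  refine ⟨u.take y ++ u.drop (y + d * L), hl, by simpa using hF, ?_, ?_⟩
  · intro i hi
    rw [tt, Nat.mod_eq_of_lt (by omega), List.getElem?_append_left (by simp; omega), htt _ (by omega),
      List.getElem?_take_of_lt hi]
  · intro i h1 h2
    rw [tt, Nat.mod_eq_of_lt (by omega), List.getElem?_append_right (by simp; omega), htt _ (by omega),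
      List.getElem?_drop]
    congr 1
    simp; omega

lemma km_small2 {k m L : ℕ} (hk : 3 ≤ k) (hm : 1 ≤ m) (h : k * (m * L) < 2 * (m * L) + 3 * L) :
    (k = 3 ∧ m = 1) ∨ (k = 4 ∧ m = 1) ∨ (k = 3 ∧ m = 2) := by
  obtain ⟨k', rfl⟩ : ∃ k', k = k' + 3 := ⟨k - 3, by omega⟩
  have h' : ((k' + 1) * m) * L < 3 * L := by nlinarith
  have h2 := Nat.lt_of_mul_lt_mul_right h'
  have h3 : m < 3 := by nlinarith
  have h4 : k' < 2 := by nlinarith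
  interval_cases m <;> interval_cases k' <;> simp_all

/-- the case of one square of blocks at the beginning or the end -/
lemma s3m1 {α β : Type*} {k L B : ℕ} {g : α → List β} (C : Ctx k g L B) (u : List β) (hu : Cls g k L u)
    (h3 : u.length < 3 * L)
    (h : (∀ x < L, tt u x = tt u (x + L)) ∨ ∀ x < L, tt u (u.length - 2 * L + x) = tt u (u.length - L + x)) :
    False := by
  have hL := C.hL
  have hgt := hu.gt
  rcases h with h | h
  · obtain ⟨v, v1, v2, v3, v4⟩ := del C u 0 1 le_rfl (by omega) (by simpa using h) hu.occ
    simp only [Nat.one_mul] at *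
    obtain ⟨hk, hl⟩ := level2 C v v2 (by omega) (by omega)
    have hins := ins (tt u) (tt v) u.length v.length L v1.symm (by omega) (tt_add u) h (tt_add v)
      (fun i hi => v4 i (by omega) hi)
    rcases hl with hl | hl
    · have := hins v.length (2 * L) (by omega) (by omega) (by omega) (by
        intro x hx1 hx2
        obtain ⟨z, rfl⟩ : ∃ z, x = z + v.length := ⟨x - v.length, by omega⟩
        rw [tt_add, show z + v.length + L = z + L + v.length by omega, tt_add]
        exact hl z (by omega))
      exact hu.K hk ⟨v.length + L, fun x hx => this _ (by omega) (by omega)⟩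
    · have := hins (2 * v.length - 2 * L) (2 * L) (by omega) (by omega) (by omega) (by
        intro x hx1 hx2
        rw [← tt_add v x, ← tt_add v (x + L)]
        have := hl (x - (2 * v.length - 2 * L)) (by omega)
        rw [show 3 * v.length - 2 * L + (x - (2 * v.length - 2 * L)) = x + v.length by omega,
          show 3 * v.length - L + (x - (2 * v.length - 2 * L)) = x + L + v.length by omega] at this
        exact this)
      exact hu.K hk ⟨2 * v.length - 2 * L + L, fun x hx => this _ (by omega) (by omega)⟩
  · obtain ⟨v, v1, v2, v3, v4⟩ := del C u (u.length - 2 * L) 1 le_rfl (by omega) (fun x hx => by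
      rw [h x hx]; congr 1; omega) hu.occ
    simp only [Nat.one_mul] at *
    obtain ⟨hk, hl⟩ := level2 C v v2 (by omega) (by omega)
    have hv : ∀ i < v.length, tt v i = tt u i := by
      intro i hi
      by_cases hc : i < u.length - 2 * L
      · exact v3 i hc
      · rw [v4 i (by omega) hi]
        have := h (i - (u.length - 2 * L)) (by omega)
        rw [show u.length - 2 * L + (i - (u.length - 2 * L)) = i by omega,
          show u.length - L + (i - (u.length - 2 * L)) = i + L by omega] at this
        exact this.symm
    have hins := ins (fun x => tt u (u.length - 2 * L + x)) (fun i => tt v (v.length - L + i)) u.length v.length L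
      v1.symm (by omega) (fun x => by rw [← Nat.add_assoc, tt_add])
      (fun x hx => by rw [h x hx]; congr 1; omega)
      (fun x => by rw [← Nat.add_assoc, tt_add])
      (fun i hi => by
        by_cases hc : i < L
        · rw [hv _ (by omega), show u.length - 2 * L + (i + L) = u.length - L + i by omega, ← h i hc]
          congr 1; omega
        · rw [show v.length - L + i = (i - L) + v.length by omega, tt_add, hv _ (by omega), ← tt_add u]
          congr 1; omega)
    rcases hl with hl | hl
    · have := hins L (2 * L) (by omega) (by omega) (by omega) (by
        intro x hx1 hx2
        show tt v (v.length - L + x) = tt v (v.length - L + (x + L))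
        rw [show v.length - L + x = (x - L) + v.length by omega, tt_add, hl _ (by omega),
          show v.length - L + (x + L) = x - L + L + v.length by omega, tt_add])
      exact hu.K hk ⟨u.length - 2 * L + (L + L), fun x hx => by
        have := this (L + L + x) (by omega) (by omega)
        rw [Nat.add_assoc, this]; congr 1; omega⟩
    · have := hins (v.length - L) (2 * L) (by omega) (by omega) (by omega) (by
        intro x hx1 hx2
        have := hl (x - (v.length - L)) (by omega)
        show tt v (v.length - L + x) = tt v (v.length - L + (x + L))
        rw [← tt_add v (v.length - L + x), ← tt_add v (v.length - L + (x + L))]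
        rw [show v.length - L + x + v.length = 3 * v.length - 2 * L + (x - (v.length - L)) by omega, this]
        congr 1; omega)
      exact hu.K hk ⟨u.length - 2 * L + (v.length - L + L), fun x hx => by
        have := this (v.length - L + L + x) (by omega) (by omega)
        rw [Nat.add_assoc, this]; congr 1; omega⟩

lemma s3m2 {α β : Type*} {k L B : ℕ} {g : α → List β} (C : Ctx k g L B) (u : List β) (hu : Cls g k L u)
    (hmin : ∀ u', Cls g k L u' → u.length ≤ u'.length) 
    (h3 : 3 * L < u.length) (h4 : u.length < 4 * L)
    (h : ∀ x, x + 2 * L < u.length → tt u x = tt u (x + 2 * L)) : False := by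
  have hL := C.hL
  obtain ⟨v, v1, v2, v3, v4⟩ := del C u 0 2 (by omega) (by omega) (fun x hx => by
    rw [Nat.zero_add]; exact h x (by omega)) hu.occ
  obtain ⟨hk, hl⟩ := level2 C v v2 (by omega) (by omega)
  have ext : ∀ i < 2 * v.length, tt v i = tt u (i + 2 * L) := by
    intro i hi
    by_cases hc : i < v.length
    · exact v4 i (by omega) hc
    · obtain ⟨j, rfl⟩ : ∃ j, i = j + v.length := ⟨i - v.length, by omega⟩
      rw [tt_add, v4 j (by omega) (by omega), ← h j (by omega), ← tt_add u]
      congr 1; omega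
  have hwin : ∃ y, ∀ x < L, tt u (y + x) = tt u (y + x + 1 * L) := by
    rcases hl with hl | hl
    · refine ⟨2 * L, fun x hx => ?_⟩
      have := hl x hx
      rw [ext _ (by omega), ext _ (by omega)] at this
      rw [Nat.add_comm (2 * L), this]; congr 1; omega
    · refine ⟨2 * v.length, fun x hx => ?_⟩
      have := hl x hx
      rw [show 3 * v.length - 2 * L + x = 2 * v.length - 2 * L + x + v.length by omega, tt_add,
        show 3 * v.length - L + x = 2 * v.length - L + x + v.length by omega, tt_add,
        ext _ (by omega), ext _ (by omega)] at this
      rw [show 2 * v.length + x = 2 * v.length - 2 * L + x + 2 * L by omega, this]; congr 1; omega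
  obtain ⟨y, hy⟩ := hwin
  have := star C u hu hmin 1 le_rfl (by omega) y hy
  omega

lemma s3 {α β : Type*} {k L B : ℕ} {g : α → List β} (C : Ctx k g L B) (u : List β) (hu : Cls g k L u)
    (hmin : ∀ u', Cls g k L u' → u.length ≤ u'.length) (V : List α) (s : ℕ) (hs : s < L)
    (hl1 : s + k * u.length ≤ V.length * L) (hl2 : V.length * L < s + k * u.length + L)
    (hT : ∀ x < k * u.length, T g V (s + x) = u[x % u.length]?)
    (m0 : ℕ) (hm0 : ∃ i, 1 ≤ m0 ∧ i + k * m0 ≤ V.length ∧ Per (fun x => V[x]?) m0 i (i + k * m0))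
    (hmB : (k - 1) * m0 ≤ B) : False := by
  have hk := C.hk
  have hL := C.hL
  have hgt := hu.gt
  have hper := per_of_T V u s hT
  obtain ⟨m, i, hmm, hm, him, hWp, hmin'⟩ := min_pow k (by omega) V m0 hm0
  have hkm : (k - 1) * m ≤ (k - 1) * m0 := Nat.mul_le_mul_left _ hmm
  obtain ⟨a, b, ha, hb, hab, hO, hlen, hc⟩ := fwbad C V s u.length hu.nd (by omega) hs hl1 hl2 hper i m hm him
    hWp hmin' (by omega)
  have hML : L ≤ m * L := Nat.le_mul_of_pos_left _ hm
  have hkM : 3 * (m * L) ≤ k * (m * L) := Nat.mul_le_mul_right _ hk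
  have hO' : ∀ x, a ≤ s + x → s + x + m * L < b → tt u x = tt u (x + m * L) := by
    intro x h1 h2
    have := hO (s + x) h1 h2
    rw [Nat.add_assoc, hT _ (by omega), hT _ (by omega)] at this
    exact this
  have hlb : a + k * (m * L) + 1 ≤ b + L := by
    rcases hc with hc | ⟨rfl, hc⟩ | ⟨-, hc⟩
    · omega
    · exact hc
    · exact hc
  have hmp : (m + 1) * L ≤ u.length := by
    rw [Nat.add_mul]
    by_cases h1 : m = 1
    · subst h1; omega
    · have : 2 * L ≤ m * L := Nat.mul_le_mul_right _ (by omega)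
      omega
  have hst := star C u hu hmin m hm hmp (a - s) (fun x hx => hO' _ (by omega) (by omega))
  rw [Nat.add_mul] at hst
  have hcases := km_small2 (k := k) (m := m) (L := L) hk hm (by omega)
  rcases hc with hc | hc
  · rcases hcases with ⟨rfl, rfl⟩ | ⟨rfl, rfl⟩ | ⟨rfl, rfl⟩
    · exact hu.K rfl ⟨a - s, fun x hx => by
        have := hO' (a - s + x) (by omega) (by omega)
        rwa [Nat.one_mul] at this⟩
    · omega
    · omega
  have hp3 : m = 1 → k * u.length = k * u.length - u.length + u.length := by
    intro _
    have : u.length ≤ k * u.length := Nat.le_mul_of_pos_left _ (by omega)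
    omega
  have hm1 : m = 1 → False := by
    rintro rfl
    refine s3m1 C u hu (by omega) ?_
    simp only [Nat.one_mul] at *
    rcases hc with ⟨rfl, hc⟩ | ⟨rfl, hc⟩
    · left
      intro x hx
      exact hO' x (by omega) (by omega)
    · right
      intro x hx
      obtain ⟨K, rfl⟩ : ∃ K, k = K + 1 := ⟨k - 1, by omega⟩
      have e : (K + 1) * u.length = K * u.length + u.length := by ring
      have := hO' (K * u.length + (u.length - 2 * L + x)) (by omega) (by omega)
      have q : ∀ z, tt u (K * u.length + z) = tt u z := fun z => tt_mod _ _ _ (by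
        rw [Nat.add_comm, Nat.add_mul_mod_self_right])
      rw [q, Nat.add_assoc, q] at this
      rw [this]; congr 1; omega
  rcases hcases with ⟨rfl, h⟩ | ⟨rfl, h⟩ | ⟨rfl, h⟩
  · exact hm1 h
  · exact hm1 h
  · subst h
    refine s3m2 C u hu hmin (by omega) (by omega) ?_
    rcases hc with ⟨rfl, hc⟩ | ⟨rfl, hc⟩
    · intro x hx
      exact hO' x (by omega) (by omega)
    · intro x hx
      have := hO' (x + u.length + u.length) (by omega) (by omega)
      rw [tt_add, tt_add, show x + u.length + u.length + 2 * L = x + 2 * L + u.length + u.length by omega,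
        tt_add, tt_add] at this
      exact this

end TB

namespace TB

lemma cls_of_bad {α β : Type*} {k L B : ℕ} {g : α → List β} (C : Ctx k g L B) (w : List α)
    (hw : kPowerFree k w) (u : List β) (hu : u ≠ []) (hin : wpow u k <:+: applyMorph g w) : Cls g k L u := by
  have hk := C.hk
  have hL := C.hL
  have hB := C.hB
  have hp : 1 ≤ u.length := List.length_pos_iff.2 hu
  obtain ⟨V, s, hVw, hs, hl1, hl2, hT⟩ := trim C w u hin
  have hV := kpf_infix hVw hw
  have hper := per_of_T V u s hT
  have hgt : 2 * L < u.length := by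
    by_contra hc
    refine C.noPer V ?_ hV u.length hp s hl1 hper
    have : k * u.length ≤ k * (2 * L) := Nat.mul_le_mul_left _ (by omega)
    have h3 : V.length * L < (2 * k + 2) * L := by
      have : (2 * k + 2) * L = k * (2 * L) + 2 * L := by ring
      omega
    have := Nat.lt_of_mul_lt_mul_right h3
    omega
  refine ⟨?_, hgt, ⟨w, hin⟩, ?_⟩
  · rintro ⟨c, hc⟩
    rw [Nat.mul_comm] at hc
    rw [hc] at hper hl1
    refine case1 C V hV c s ?_ hl1 hper
    by_contra h0
    have : c = 0 := by omega
    subst this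
    omega
  · rintro rfl ⟨y, hy⟩
    have hy0 : y % u.length < u.length := Nat.mod_lt _ (by omega)
    refine case1 C V hV 1 (s + y % u.length) le_rfl (by omega) ?_
    intro x h1 h2
    have := hy (x - (s + y % u.length)) (by omega)
    rw [Nat.add_assoc, ← tt_modadd, ← tt_modadd u y] at this
    obtain ⟨z, rfl⟩ : ∃ z, x = s + z := ⟨x - s, by omega⟩
    rw [Nat.add_assoc, hT _ (by omega), hT _ (by omega)]
    rw [show y % u.length + (s + z - (s + y % u.length)) = z by omega,
      show y % u.length + (s + z - (s + y % u.length) + L) = z + 1 * L by omega] at this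
    exact this

lemma exists_min_cls {α β : Type*} {g : α → List β} {k L : ℕ} (u : List β) (h : Cls g k L u) :
    ∃ u, Cls g k L u ∧ ∀ u', Cls g k L u' → u.length ≤ u'.length := by
  classical
  have hP : ∃ n, ∃ u, Cls g k L u ∧ u.length = n := ⟨_, u, h, rfl⟩
  obtain ⟨v, hv, hl⟩ := Nat.find_spec hP
  exact ⟨v, hv, fun u' hu' => by rw [hl]; exact Nat.find_min' hP ⟨u', hu', rfl⟩⟩

lemma finish {α β : Type*} [Fintype α] {k L : ℕ} {g : α → List β}
    (C : Ctx k g L (k * Fintype.card α + k + 1)) (hn : 1 ≤ Fintype.card α) (u : List β) (hu : Cls g k L u)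
    (hmin : ∀ u', Cls g k L u' → u.length ≤ u'.length) : False := by
  have hk := C.hk
  have hL := C.hL
  have hgt := hu.gt
  obtain ⟨W, hW⟩ := hu.occ
  obtain ⟨V, s, -, hs, hl1, hl2, hT⟩ := trim C W u hW
  have hper := per_of_T V u s hT
  by_cases hc : u.length < (Fintype.card α + 1) * L
  · have hVB : V.length ≤ k * Fintype.card α + k + 1 := by
      have h1 : k * u.length ≤ k * ((Fintype.card α + 1) * L) := Nat.mul_le_mul_left _ hc.le
      have h3 : V.length * L < (k * Fintype.card α + k + 2) * L := by
        have : (k * Fintype.card α + k + 2) * L = k * ((Fintype.card α + 1) * L) + 2 * L := by ring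
        omega
      have := Nat.lt_of_mul_lt_mul_right h3
      omega
    by_cases hf : kPowerFree k V
    · exact C.noPer V hVB hf u.length (by omega) s hl1 hper
    · obtain ⟨m0, i0, hm0⟩ := not_kpf k (by omega) V hf
      have hkm : (k - 1) * m0 ≤ k * m0 := Nat.mul_le_mul_right _ (by omega)
      exact s3 C u hu hmin V s hs hl1 hl2 hT m0 ⟨i0, hm0⟩ (by omega)
  · push Not at hc
    have hbd : (k * Fintype.card α + 1) * L ≤ k * u.length := by
      have h1 : k * ((Fintype.card α + 1) * L) ≤ k * u.length := Nat.mul_le_mul_left _ hc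
      have h2 : k * ((Fintype.card α + 1) * L) = (k * Fintype.card α) * L + k * L := by ring
      have h3 : 1 * L ≤ k * L := Nat.mul_le_mul_right _ (by omega)
      rw [Nat.add_mul]; omega
    have hVl : k * Fintype.card α + 1 ≤ V.length := by
      have : (k * Fintype.card α + 1) * L ≤ V.length * L := by omega
      exact Nat.le_of_mul_le_mul_right this hL
    have hknn : (k - 1) * Fintype.card α ≤ k * Fintype.card α := Nat.mul_le_mul_right _ (by omega)
    refine s3 C u hu hmin V s hs hl1 hl2 hT (Fintype.card α) ⟨1, hn, by omega, ?_⟩ (by omega)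
    intro j hj1 hj2
    have hlen : ∀ i : Fin (Fintype.card α + 1), j + i.val < V.length := fun i => by have := i.isLt; omega
    obtain ⟨i1, i2, hne, heq⟩ := Fintype.exists_ne_map_eq_of_card_lt
      (fun i : Fin (Fintype.card α + 1) => V[j + i.val]'(hlen i)) (by simp)
    have key : ∀ i1 i2 : ℕ, i1 < i2 → i2 ≤ Fintype.card α → V[j + i1]? = V[j + i2]? →
        V[j]? = V[j + Fintype.card α]? := by
      intro i1 i2 h12 h2n he
      have hbl : (j + i2 + 1) * L ≤ (k * Fintype.card α + 1) * L := Nat.mul_le_mul_right _ (by omega)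
      have hjL : L ≤ (j + i1) * L := Nat.le_mul_of_pos_left _ (by omega)
      have e1 : (j + i2 + 1) * L = (j + i2) * L + L := by ring
      have e2 : (j + i1) * L + (i2 - i1) * L = (j + i2) * L := by
        rw [← Nat.add_mul]; congr 1; omega
      have hst := star C u hu hmin (i2 - i1) (by omega)
        ((Nat.mul_le_mul_right _ (by omega)).trans hc) ((j + i1) * L - s) (fun x hx => by
          have q1 := hT ((j + i1) * L - s + x) (by omega)
          have q2 := hT ((j + i1) * L - s + x + (i2 - i1) * L) (by omega)
          rw [show s + ((j + i1) * L - s + x) = (j + i1) * L + x by omega, T_blk C _ _ _ hx] at q1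
          rw [show s + ((j + i1) * L - s + x + (i2 - i1) * L) = (j + i2) * L + x by omega, T_blk C _ _ _ hx] at q2
          rw [tt, tt, ← q1, ← q2, he])
      have hlt := Nat.lt_of_mul_lt_mul_right (hc.trans_lt hst)
      have h1 : i1 = 0 := by omega
      have h2 : i2 = Fintype.card α := by omega
      subst h1; subst h2
      simpa using he
    have he : V[j + i1.val]? = V[j + i2.val]? := by
      rw [List.getElem?_eq_getElem (hlen i1), List.getElem?_eq_getElem (hlen i2)]
      exact congrArg some heq
    have hne' : i1.val ≠ i2.val := fun h => hne (Fin.ext h)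
    have b1 := i1.isLt
    have b2 := i2.isLt
    rcases Nat.lt_or_gt_of_ne hne' with h | h
    · exact key _ _ h (by omega) he
    · exact key _ _ h (by omega) he.symm

end TB

theorem test_bound_uniform {α β : Type*} [Fintype α]
    (k : ℕ) (hk : 3 ≤ k)
    (g : α → List β) (L : ℕ) (huniform : ∀ a : α, (g a).length = L) :
    (∀ w : List α, kPowerFree k w → kPowerFree k (applyMorph g w)) ↔
    (∀ w : List α, w.length ≤ k * Fintype.card α + k + 1 → kPowerFree k w →
      kPowerFree k (applyMorph g w)) := by
  constructor
  · intro h w _ hw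
    exact h w hw
  · intro H w hw u hu hin
    have hlen := hin.length_le
    rw [TB.wpow_length, TB.len_f g L huniform] at hlen
    have hp : 1 ≤ u.length := List.length_pos_iff.2 hu
    have hkp : 0 < k * u.length := Nat.mul_pos (by omega) hp
    have hpos : 0 < w.length * L := by omega
    have hL : 0 < L := Nat.pos_of_mul_pos_left hpos
    have hwl : 0 < w.length := Nat.pos_of_mul_pos_right hpos
    have hn : 1 ≤ Fintype.card α := Fintype.card_pos_iff.2 ⟨w[0]⟩
    have hkn : k * 1 ≤ k * Fintype.card α := Nat.mul_le_mul_left _ hn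
    have C : TB.Ctx k g L (k * Fintype.card α + k + 1) := ⟨hk, huniform, hL, H, by omega⟩
    obtain ⟨v, hv, hmin⟩ := TB.exists_min_cls u (TB.cls_of_bad C w hw u hu hin)
    exact TB.finish C hn v hv hmin
end
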